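/- arXiv:1602.07629 — 4 statements merged into one kernel-verified Lean document; each statement's English description precedes it below -/
import Mathlib

section
/- Let n ≥ 2 and let μ and ν be compactly supported Borel probability measures on ℝⁿ with disjoint supports. Then there exists a constant c > 0, independent of δ, such that for every δ ∈ (0,1), ∫_{S^{n−1}} f_δ(e) dσ^{n−1}(e) ≥ c, where f_δ(e) = ∫ (∫_ℝ μ_δ(π_{V_e}(x) + t e) dt) dν(x). -/
open MeasureTheory Metric Set Filter
open scoped ENNReal NNReal Topology RealInnerProductSpace

/-- The (closed) support of a measure. -/
def msupport {α : Type*} [TopologicalSpace α] [MeasurableSpace α]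
    (ν : MeasureTheory.Measure α) : Set α :=
  {x | ∀ U ∈ 𝓝 x, ν U ≠ 0}

/-- The mollification `μ_δ = μ ∗ ψ_δ`, where `ψ_δ(x) = δ⁻ⁿ ψ(x/δ)`:
`μ_δ(z) = ∫ ψ_δ(z - y) dμ(y)`. -/
noncomputable def mollified {n : ℕ} (ψ : EuclideanSpace ℝ (Fin n) → ℝ)
    (μ : MeasureTheory.Measure (EuclideanSpace ℝ (Fin n))) (δ : ℝ)
    (z : EuclideanSpace ℝ (Fin n)) : ℝ :=
  ∫ y, (δ ^ n)⁻¹ * ψ (δ⁻¹ • (z - y)) ∂μ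

/-- The function `f_δ(e) = ∫ (∫_ℝ μ_δ(π_{V_e}(x) + t e) dt) dν(x)`, where `π_{V_e}` is the
orthogonal projection onto the hyperplane `V_e = {e}ᗮ`. -/
noncomputable def lineAvg {n : ℕ} (ψ : EuclideanSpace ℝ (Fin n) → ℝ)
    (μ ν : MeasureTheory.Measure (EuclideanSpace ℝ (Fin n))) (δ : ℝ)
    (e : EuclideanSpace ℝ (Fin n)) : ℝ :=
  ∫ x, (∫ t : ℝ, mollified ψ μ δ ((x - ⟪x, e⟫ • e) + t • e)) ∂ν

section Sphere

open Module
open scoped Pointwise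

variable {E : Type*} [NormedAddCommGroup E] [InnerProductSpace ℝ E] [FiniteDimensional ℝ E]
  [MeasurableSpace E] [BorelSpace E]

/-- The half of the unit sphere facing away from a unit vector `v` has finite `(d - 1)`-dimensional
Hausdorff measure: it is a Lipschitz image of a ball under the inverse stereographic projection. -/
theorem hausdorffMeasure_halfSphere_lt_top {v : E} (hv : ‖v‖ = 1) :
    μH[(finrank ℝ E : ℝ) - 1] (sphere (0 : E) 1 ∩ {x | ⟪v, x⟫ ≤ 0}) < ∞ := by
  have hv0 : v ≠ 0 := by rintro rfl; simp at hv
  have hrank : (finrank ℝ E : ℝ) - 1 = finrank ℝ (ℝ ∙ v)ᗮ := by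
    have h := (ℝ ∙ v).finrank_add_finrank_orthogonal
    rw [finrank_span_singleton hv0] at h
    rw [← h]; push_cast; ring
  rw [hrank]
  set F : (ℝ ∙ v)ᗮ → E := fun w ↦ stereoInvFunAux v (w : E) with hF
  have hFs : ContDiff ℝ 1 F := contDiff_stereoInvFunAux.comp (ℝ ∙ v)ᗮ.subtypeL.contDiff
  have hcpt : IsCompact (closedBall (0 : (ℝ ∙ v)ᗮ) 2) := isCompact_closedBall 0 2
  obtain ⟨K, hK⟩ := LocallyLipschitzOn.exists_lipschitzOnWith_of_compact hcpt
    hFs.locallyLipschitz.locallyLipschitzOn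
  have hsub : sphere (0 : E) 1 ∩ {x | ⟪v, x⟫ ≤ 0} ⊆ F '' closedBall 0 2 := by
    rintro x ⟨hx, hxv⟩
    have hxv : ⟪v, x⟫ ≤ 0 := hxv
    have hx1 : ‖x‖ = 1 := by simpa using hx
    have hne : x ≠ v := by
      rintro rfl
      rw [real_inner_self_eq_norm_sq, hx1] at hxv
      norm_num at hxv
    refine ⟨stereoToFun v x, ?_, ?_⟩
    · rw [mem_closedBall_zero_iff, stereoToFun_apply, norm_smul, innerSL_apply_apply,
        Real.norm_of_nonneg (by apply div_nonneg <;> linarith)]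
      have h1 : 2 / (1 - ⟪v, x⟫) ≤ 2 := div_le_self (by norm_num) (by linarith)
      have h2 : ‖(ℝ ∙ v)ᗮ.orthogonalProjectionOnto x‖ ≤ 1 :=
        hx1 ▸ Submodule.norm_orthogonalProjectionOnto_apply_le _ x
      calc _ ≤ (2 : ℝ) * 1 := by gcongr
        _ = 2 := by norm_num
    · exact congrArg Subtype.val (stereo_left_inv hv (x := ⟨x, hx⟩) hne)
  calc _ ≤ μH[finrank ℝ (ℝ ∙ v)ᗮ] (F '' closedBall 0 2) := measure_mono hsub
    _ ≤ (K : ℝ≥0∞) ^ (finrank ℝ (ℝ ∙ v)ᗮ : ℝ) * μH[finrank ℝ (ℝ ∙ v)ᗮ] (closedBall 0 2) :=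
      hK.hausdorffMeasure_image_le (Nat.cast_nonneg _)
    _ < ∞ := ENNReal.mul_lt_top (by simp) hcpt.measure_lt_top

theorem hausdorffMeasure_unitSphere_lt_top :
    μH[(finrank ℝ E : ℝ) - 1] (sphere (0 : E) 1) < ∞ := by
  rcases (sphere (0 : E) 1).eq_empty_or_nonempty with h | ⟨v, hv⟩
  · simp [h]
  have hv : ‖v‖ = 1 := by simpa using hv
  refine (measure_mono (t := (sphere (0 : E) 1 ∩ {x | ⟪v, x⟫ ≤ 0}) ∪
    (sphere (0 : E) 1 ∩ {x | ⟪-v, x⟫ ≤ 0})) ?_).trans_lt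
    (measure_union_lt_top (hausdorffMeasure_halfSphere_lt_top hv)
      (hausdorffMeasure_halfSphere_lt_top (by simpa using hv)))
  intro x hx
  rcases le_total ⟪v, x⟫ 0 with h | h
  · exact .inl ⟨hx, h⟩
  · exact .inr ⟨hx, by simpa [inner_neg_left] using h⟩

variable (m : Measure E) [m.IsAddHaarMeasure]

/-- The cone over a small ball of the sphere is covered by about `1 / r` balls of radius `2 * r`. -/
theorem toSphere_closedBall_le (x : sphere (0 : E) 1) {r : ℝ} (hr : 0 < r) (hr1 : r ≤ 1) :
    m.toSphere (closedBall x r) ≤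
      ENNReal.ofReal (finrank ℝ E * 2 ^ (finrank ℝ E + 1) * m.real (ball 0 1)
        * r ^ (finrank ℝ E - 1)) := by
  have hnt : Nontrivial E := ⟨⟨x, 0, ne_of_apply_ne Norm.norm (by simp)⟩⟩
  have hd : finrank ℝ E - 1 + 1 = finrank ℝ E := Nat.sub_add_cancel finrank_pos
  set N : ℕ := ⌊1 / r⌋₊ + 1 with hN
  have hsub : Ioo (0 : ℝ) 1 • ((↑) '' closedBall x r : Set E) ⊆
      ⋃ k ∈ Finset.range N, closedBall ((k * r) • (x : E)) (2 * r) := by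
    rintro _ ⟨t, ht, _, ⟨u, hu, rfl⟩, rfl⟩
    have hk : ⌊t / r⌋₊ < N :=
      Nat.lt_succ_of_le (Nat.floor_le_floor (by gcongr; exact ht.2.le))
    refine mem_iUnion₂.2 ⟨⌊t / r⌋₊, Finset.mem_range.2 hk, ?_⟩
    have h1 : (⌊t / r⌋₊ : ℝ) * r ≤ t :=
      (le_div_iff₀ hr).1 (Nat.floor_le (div_nonneg ht.1.le hr.le))
    have h2 : t < ((⌊t / r⌋₊ : ℝ) + 1) * r := (div_lt_iff₀ hr).1 (Nat.lt_floor_add_one _)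
    have hux : ‖(u : E) - x‖ ≤ r := by
      rw [mem_closedBall, Subtype.dist_eq, dist_eq_norm] at hu
      exact hu
    have hx : ‖(x : E)‖ = 1 := by simp
    rw [mem_closedBall, dist_eq_norm]
    calc ‖t • (u : E) - (⌊t / r⌋₊ * r) • (x : E)‖
        = ‖t • ((u : E) - x) + (t - ⌊t / r⌋₊ * r) • (x : E)‖ := by
          congr 1; module
      _ ≤ ‖t • ((u : E) - x)‖ + ‖(t - ⌊t / r⌋₊ * r) • (x : E)‖ := norm_add_le _ _
      _ ≤ 1 * r + r * 1 := by
          rw [norm_smul, norm_smul, Real.norm_of_nonneg ht.1.le, Real.norm_of_nonneg (by linarith),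
            hx]
          gcongr
          · exact ht.2.le
          · linarith
      _ = 2 * r := by ring
  have hNr : (N : ℝ) ≤ 2 / r := by
    have h1 : (⌊1 / r⌋₊ : ℝ) ≤ 1 / r := Nat.floor_le (by positivity)
    have h2 : 1 ≤ 1 / r := by rw [le_div_iff₀ hr]; linarith
    rw [hN]; push_cast
    calc _ ≤ 1 / r + 1 / r := by gcongr
      _ = 2 / r := by ring
  have hfin : m (ball 0 1) ≠ ∞ := measure_ball_lt_top.ne
  rw [Measure.toSphere_apply' _ measurableSet_closedBall]
  calc (finrank ℝ E : ℝ≥0∞) * m (Ioo (0 : ℝ) 1 • ((↑) '' closedBall x r : Set E))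
      ≤ finrank ℝ E * ∑ k ∈ Finset.range N, m (closedBall ((k * r) • (x : E)) (2 * r)) := by
        gcongr
        exact (measure_mono hsub).trans (measure_biUnion_finset_le _ _)
    _ = ENNReal.ofReal (finrank ℝ E * (N * ((2 * r) ^ finrank ℝ E * m.real (ball 0 1)))) := by
        simp_rw [Measure.addHaar_closedBall m _ (show 0 ≤ 2 * r by positivity)]
        rw [Finset.sum_const, Finset.card_range, nsmul_eq_mul, ENNReal.ofReal_mul (by positivity),
          ENNReal.ofReal_mul (by positivity), ENNReal.ofReal_mul (by positivity),
          ENNReal.ofReal_natCast, ENNReal.ofReal_natCast, ofReal_measureReal hfin]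
    _ ≤ _ := by
        apply ENNReal.ofReal_le_ofReal
        calc _ ≤ (finrank ℝ E : ℝ) * (2 / r * ((2 * r) ^ finrank ℝ E * m.real (ball 0 1))) := by
              gcongr
          _ = _ := by
              obtain ⟨k, hk⟩ : ∃ k, finrank ℝ E = k + 1 := ⟨_, hd.symm⟩
              rw [hk, Nat.add_sub_cancel]
              field_simp
              ring

/-- The surface measure of the sphere is controlled by the Hausdorff measure. -/
theorem exists_toSphere_le_hausdorffMeasure [Nontrivial E] :
    ∃ C : ℝ≥0∞, C ≠ 0 ∧ C ≠ ∞ ∧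
      m.toSphere ≤ C • (μH[(finrank ℝ E : ℝ) - 1] : Measure (sphere (0 : E) 1)) := by
  have hd1 : 1 ≤ finrank ℝ E := finrank_pos
  set A : ℝ := finrank ℝ E * 2 ^ (finrank ℝ E + 1) * m.real (ball 0 1) with hA
  have hA0 : 0 < A := by
    have : 0 < m.real (ball (0 : E) 1) :=
      ENNReal.toReal_pos (measure_ball_pos m 0 one_pos).ne' measure_ball_lt_top.ne
    positivity
  have hC0 : ENNReal.ofReal A ≠ 0 := by simpa using hA0
  refine ⟨ENNReal.ofReal A, hC0, ENNReal.ofReal_ne_top, ?_⟩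
  have key : (ENNReal.ofReal A)⁻¹ • m.toSphere ≤ μH[(finrank ℝ E : ℝ) - 1] := by
    refine Measure.le_hausdorffMeasure _ _ (1 / 2 : ℝ≥0) (by simp) fun s hs ↦ ?_
    rcases s.eq_empty_or_nonempty with rfl | ⟨x, hx⟩
    · simp
    have hfin : ediam s ≠ ∞ := (hs.trans_lt (by simp)).ne
    set a := (ediam s).toReal with ha
    have hsa : ediam s = ENNReal.ofReal a := (ENNReal.ofReal_toReal hfin).symm
    have ha0 : 0 ≤ a := ENNReal.toReal_nonneg
    have ha1 : a < 1 := by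
      have := ENNReal.toReal_mono (by simp) hs
      norm_num at this
      linarith
    have hle : ∀ r ∈ Ioc a 1, m.toSphere s ≤ ENNReal.ofReal (A * r ^ (finrank ℝ E - 1)) := by
      intro r hr
      refine (measure_mono fun y hy ↦ ?_).trans
        (toSphere_closedBall_le m x (ha0.trans_lt hr.1) hr.2)
      rw [mem_closedBall, dist_edist]
      exact (ENNReal.toReal_mono hfin (edist_le_ediam_of_mem hy hx)).trans hr.1.le
    have hlim : m.toSphere s ≤ ENNReal.ofReal (A * a ^ (finrank ℝ E - 1)) := by
      have hc : Continuous fun r : ℝ ↦ ENNReal.ofReal (A * r ^ (finrank ℝ E - 1)) :=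
        ENNReal.continuous_ofReal.comp (by fun_prop)
      refine ge_of_tendsto (hc.continuousWithinAt (s := Ioi a) (x := a)).tendsto ?_
      filter_upwards [Ioc_mem_nhdsGT ha1] with r hr using hle r hr
    rw [Measure.smul_apply, smul_eq_mul, hsa,
      show (finrank ℝ E : ℝ) - 1 = (finrank ℝ E - 1 : ℕ) by rw [Nat.cast_sub hd1, Nat.cast_one],
      ENNReal.rpow_natCast, ← ENNReal.ofReal_pow ha0, mul_comm, ← div_eq_mul_inv]
    refine ENNReal.div_le_of_le_mul' ?_
    rwa [← ENNReal.ofReal_mul hA0.le]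
  calc m.toSphere = ENNReal.ofReal A • (ENNReal.ofReal A)⁻¹ • m.toSphere := by
        rw [smul_smul, ENNReal.mul_inv_cancel hC0 ENNReal.ofReal_ne_top, one_smul]
    _ ≤ _ := by
        refine Measure.le_iff.2 fun s _ ↦ ?_
        rw [Measure.smul_apply, Measure.smul_apply _ _ s, smul_eq_mul, smul_eq_mul]
        exact mul_le_mul_right (key s) _

/-- Polar coordinates: the integral of a function supported in a ball is controlled by the average
of its integrals over the lines through the origin. -/
theorem lintegral_le_lintegral_toSphere_lines {g : E → ℝ≥0∞} (hg : Measurable g) {ρ : ℝ}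
    (hρ : ∀ z, ρ < ‖z‖ → g z = 0) [Nontrivial E] :
    ∫⁻ z, g z ∂m ≤ ENNReal.ofReal (ρ ^ (finrank ℝ E - 1)) *
      ∫⁻ e, (∫⁻ t : ℝ, g (t • (e : E))) ∂m.toSphere := by
  have hmeas : Measurable fun p : sphere (0 : E) 1 × Ioi (0 : ℝ) ↦ g ((p.2 : ℝ) • (p.1 : E)) := by
    fun_prop
  calc ∫⁻ z, g z ∂m = ∫⁻ z : ({(0)}ᶜ : Set E), g z ∂(m.comap (↑)) := by
        rw [lintegral_subtype_comap (measurableSet_singleton _).compl, restrict_compl_singleton]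
    _ = ∫⁻ p, g ((p.2 : ℝ) • (p.1 : E)) ∂m.toSphere.prod (.volumeIoiPow (finrank ℝ E - 1)) := by
        rw [← m.measurePreserving_homeomorphUnitSphereProd.lintegral_comp hmeas]
        refine lintegral_congr fun z ↦ ?_
        congr 1
        have hz : ‖(z : E)‖ ≠ 0 := norm_ne_zero_iff.2 z.2
        simp [smul_smul, hz]
    _ = ∫⁻ e, (∫⁻ r, g ((r : ℝ) • (e : E)) ∂(.volumeIoiPow (finrank ℝ E - 1))) ∂m.toSphere :=
        lintegral_prod _ hmeas.aemeasurable
    _ ≤ ∫⁻ e, ENNReal.ofReal (ρ ^ (finrank ℝ E - 1)) * (∫⁻ t : ℝ, g (t • (e : E))) ∂m.toSphere := by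
        refine lintegral_mono fun e ↦ ?_
        have hge : Measurable fun t : ℝ ↦ g (t • (e : E)) := by fun_prop
        rw [Measure.volumeIoiPow, lintegral_withDensity_eq_lintegral_mul _ (by fun_prop)
          (by fun_prop), ← lintegral_const_mul _ hge]
        calc _ = ∫⁻ r in Ioi (0 : ℝ), ENNReal.ofReal (r ^ (finrank ℝ E - 1)) * g (r • (e : E)) :=
              lintegral_subtype_comap measurableSet_Ioi
                fun r : ℝ ↦ ENNReal.ofReal (r ^ (finrank ℝ E - 1)) * g (r • (e : E))
          _ ≤ ∫⁻ r in Ioi (0 : ℝ), ENNReal.ofReal (ρ ^ (finrank ℝ E - 1)) * g (r • (e : E)) := by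
              refine setLIntegral_mono' measurableSet_Ioi fun r (hr : 0 < r) ↦ ?_
              rcases le_or_gt r ρ with h | h
              · gcongr
              · rw [hρ (r • (e : E)) (by simpa [norm_smul, abs_of_pos hr] using h)]
                simp
          _ ≤ _ := setLIntegral_le_lintegral _ _
    _ = _ := by
        refine lintegral_const_mul _ ?_
        exact Measurable.lintegral_prod_right'
          (f := fun p : sphere (0 : E) 1 × ℝ ↦ g (p.2 • (p.1 : E))) (by fun_prop)

theorem exists_lintegral_le_lintegral_hausdorffMeasure_lines [Nontrivial E] (ρ : ℝ) :
    ∃ C : ℝ≥0∞, C ≠ ∞ ∧ ∀ g : E → ℝ≥0∞, Measurable g → (∀ z, ρ < ‖z‖ → g z = 0) →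
      ∫⁻ z, g z ∂m ≤
        C * ∫⁻ e in sphere (0 : E) 1, (∫⁻ t : ℝ, g (t • e)) ∂μH[(finrank ℝ E : ℝ) - 1] := by
  obtain ⟨C, -, hC, hle⟩ := exists_toSphere_le_hausdorffMeasure m
  refine ⟨ENNReal.ofReal (ρ ^ (finrank ℝ E - 1)) * C,
    ENNReal.mul_ne_top ENNReal.ofReal_ne_top hC, fun g hg hρ ↦ ?_⟩
  refine (lintegral_le_lintegral_toSphere_lines m hg hρ).trans ?_
  rw [mul_assoc]
  gcongr
  have hmeas : Measurable fun e : E ↦ ∫⁻ t : ℝ, g (t • e) :=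
    Measurable.lintegral_prod_right' (f := fun p : E × ℝ ↦ g (p.2 • p.1)) (by fun_prop)
  have hd : 0 ≤ (finrank ℝ E : ℝ) - 1 := by
    have : 1 ≤ finrank ℝ E := finrank_pos
    rw [sub_nonneg]; exact_mod_cast this
  have hmap := (isometry_subtype_coe (s := sphere (0 : E) 1)).map_hausdorffMeasure (.inl hd)
  rw [Subtype.range_coe] at hmap
  rw [← hmap, lintegral_map hmeas measurable_subtype_coe, ← smul_eq_mul, ← lintegral_smul_measure]
  exact lintegral_mono' hle le_rfl

end Sphere

section LineAverage

variable {E : Type*} [NormedAddCommGroup E] [InnerProductSpace ℝ E]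

/-- A function supported in a ball of radius `r` and bounded by `M` has integral at most `2 * r * M`
over every line. -/
theorem lintegral_line_le {φ : E → ℝ} {M r : ℝ} (hM : ∀ z, φ z ≤ M)
    (hr : ∀ z, r < ‖z‖ → φ z = 0) (p : E) {e : E} (he : ‖e‖ = 1) :
    ∫⁻ t : ℝ, ENNReal.ofReal (φ (p + t • e)) ≤ ENNReal.ofReal M * ENNReal.ofReal (2 * r) := by
  set I : Set ℝ := Icc (-⟪p, e⟫ - r) (-⟪p, e⟫ + r)
  have hle : ∀ t : ℝ, ENNReal.ofReal (φ (p + t • e)) ≤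
      I.indicator (fun _ ↦ ENNReal.ofReal M) t := by
    intro t
    by_cases ht : t ∈ I
    · rw [indicator_of_mem ht]
      exact ENNReal.ofReal_le_ofReal (hM _)
    · rw [indicator_of_notMem ht, hr, ENNReal.ofReal_zero]
      by_contra! h
      apply ht
      have h1 : |⟪p + t • e, e⟫| ≤ r := by
        refine (abs_real_inner_le_norm _ _).trans ?_
        rwa [he, mul_one]
      rw [inner_add_left, real_inner_smul_left, real_inner_self_eq_norm_sq, he, one_pow, mul_one,
        abs_le] at h1
      constructor <;> linarith [h1.1, h1.2]
  calc _ ≤ ∫⁻ t, I.indicator (fun _ ↦ ENNReal.ofReal M) t := lintegral_mono hle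
    _ = ENNReal.ofReal M * ENNReal.ofReal (2 * r) := by
      rw [lintegral_indicator_const measurableSet_Icc, Real.volume_Icc]
      congr 2
      ring

variable [FiniteDimensional ℝ E] [MeasurableSpace E] [BorelSpace E]

theorem integral_line_integral_eq_toReal {φ : E → ℝ} {M r : ℝ} (hφ : Continuous φ)
    (hφ0 : ∀ z, 0 ≤ φ z) (hM : ∀ z, φ z ≤ M) (hr : ∀ z, r < ‖z‖ → φ z = 0)
    (μ ν : Measure E) [IsProbabilityMeasure μ] [IsProbabilityMeasure ν] {e : E} (he : ‖e‖ = 1) :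
    ∫ x, (∫ t : ℝ, (∫ y, φ ((x - ⟪x, e⟫ • e) + t • e - y) ∂μ)) ∂ν =
      (∫⁻ x, (∫⁻ y, (∫⁻ t : ℝ, ENNReal.ofReal (φ (x - y + t • e))) ∂μ) ∂ν).toReal := by
  have hline (p : E) := lintegral_line_le hM hr p he
  have hbound (x : E) : ∫⁻ y, (∫⁻ t : ℝ, ENNReal.ofReal (φ (x - y + t • e))) ∂μ < ∞ :=
    calc _ ≤ ∫⁻ _, ENNReal.ofReal M * ENNReal.ofReal (2 * r) ∂μ :=
          lintegral_mono fun y ↦ hline _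
      _ < ∞ := by
          rw [lintegral_const, measure_univ, mul_one]
          exact ENNReal.mul_lt_top ENNReal.ofReal_lt_top ENNReal.ofReal_lt_top
  have hconv (z : E) : ∫ y, φ (z - y) ∂μ = (∫⁻ y, ENNReal.ofReal (φ (z - y)) ∂μ).toReal :=
    integral_eq_lintegral_of_nonneg_ae (.of_forall fun _ ↦ hφ0 _)
      (by fun_prop : Continuous fun y ↦ φ (z - y)).aestronglyMeasurable
  have hconv_lt (z : E) : ∫⁻ y, ENNReal.ofReal (φ (z - y)) ∂μ < ∞ :=
    calc _ ≤ ∫⁻ _, ENNReal.ofReal M ∂μ :=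
          lintegral_mono fun y ↦ ENNReal.ofReal_le_ofReal (hM _)
      _ < ∞ := by simp
  have hφm : Measurable φ := hφ.measurable
  have hshift (x y : E) : ∫⁻ t : ℝ, ENNReal.ofReal (φ ((x - ⟪x, e⟫ • e) + t • e - y)) =
      ∫⁻ t : ℝ, ENNReal.ofReal (φ (x - y + t • e)) := by
    rw [← lintegral_sub_right_eq_self (μ := (volume : Measure ℝ))
      (fun t ↦ ENNReal.ofReal (φ (x - y + t • e))) ⟪x, e⟫]
    congr 1 with t
    congr 2
    module
  have hinner (x : E) : ∫ t : ℝ, (∫ y, φ ((x - ⟪x, e⟫ • e) + t • e - y) ∂μ) =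
      (∫⁻ y, (∫⁻ t : ℝ, ENNReal.ofReal (φ (x - y + t • e))) ∂μ).toReal := by
    simp_rw [hconv]
    rw [integral_toReal _ (.of_forall fun t ↦ hconv_lt _), lintegral_lintegral_swap]
    · simp_rw [hshift]
    · apply Measurable.aemeasurable
      unfold Function.uncurry
      fun_prop
    · apply Measurable.aemeasurable
      exact Measurable.lintegral_prod_right'
        (f := fun p : ℝ × E ↦ ENNReal.ofReal (φ ((x - ⟪x, e⟫ • e) + p.1 • e - p.2)))
        (by fun_prop)
  simp_rw [hinner]
  refine integral_toReal (Measurable.aemeasurable ?_) (.of_forall hbound)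
  refine Measurable.lintegral_prod_right'
    (f := fun p : E × E ↦ ∫⁻ t : ℝ, ENNReal.ofReal (φ (p.1 - p.2 + t • e))) ?_
  exact Measurable.lintegral_prod_right'
    (f := fun p : (E × E) × ℝ ↦ ENNReal.ofReal (φ (p.1.1 - p.1.2 + p.2 • e))) (by fun_prop)

open Module in
/-- Uniform lower bound for the average over the sphere of the line averages of a probability
density supported in the unit ball. -/
theorem exists_le_lintegral_sphere_line [Nontrivial E] (m : Measure E) [m.IsAddHaarMeasure]
    (μ ν : Measure E) [IsProbabilityMeasure μ] [IsProbabilityMeasure ν]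
    {R : ℝ} (hμ : ∀ᵐ y ∂μ, ‖y‖ ≤ R) (hν : ∀ᵐ x ∂ν, ‖x‖ ≤ R) :
    ∃ C : ℝ≥0∞, C ≠ ∞ ∧ ∀ g : E → ℝ≥0∞, Measurable g → (∀ z, 1 < ‖z‖ → g z = 0) →
      ∫⁻ z, g z ∂m = 1 →
      1 ≤ C * ∫⁻ e in sphere (0 : E) 1, (∫⁻ x, (∫⁻ y, (∫⁻ t : ℝ, g (x - y + t • e)) ∂μ) ∂ν)
        ∂μH[(finrank ℝ E : ℝ) - 1] := by
  obtain ⟨C, hC, hle⟩ := exists_lintegral_le_lintegral_hausdorffMeasure_lines m (2 * R + 1)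
  refine ⟨C, hC, fun g hg hg1 hint ↦ ?_⟩
  have : IsFiniteMeasure
      ((μH[(finrank ℝ E : ℝ) - 1] : Measure E).restrict (sphere (0 : E) 1)) :=
    isFiniteMeasure_restrict.2 hausdorffMeasure_unitSphere_lt_top.ne
  have hmeas4 : Measurable fun p : ((E × E) × E) × ℝ ↦ g (p.1.1.2 - p.1.2 + p.2 • p.1.1.1) := by
    fun_prop
  have hmeas3 : Measurable fun p : (E × E) × E ↦ ∫⁻ t : ℝ, g (p.1.2 - p.2 + t • p.1.1) :=
    hmeas4.lintegral_prod_right'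
  have hmeas2 : Measurable fun p : E × E ↦ ∫⁻ y, (∫⁻ t : ℝ, g (p.2 - y + t • p.1)) ∂μ :=
    hmeas3.lintegral_prod_right'
  rw [lintegral_lintegral_swap hmeas2.aemeasurable]
  have hswap (x : E) := lintegral_lintegral_swap
    (μ := (μH[(finrank ℝ E : ℝ) - 1] : Measure E).restrict (sphere (0 : E) 1)) (ν := μ)
    (f := fun e y ↦ ∫⁻ t : ℝ, g (x - y + t • e))
    (hmeas3.comp (f := fun p : E × E ↦ ((p.1, x), p.2)) (by fun_prop)).aemeasurable
  simp_rw [hswap]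
  rw [← lintegral_const_mul' _ _ hC]
  have hone : ∀ᵐ x ∂ν, 1 ≤ C * ∫⁻ y, (∫⁻ e in sphere (0 : E) 1, (∫⁻ t : ℝ, g (x - y + t • e))
      ∂μH[(finrank ℝ E : ℝ) - 1]) ∂μ := by
    filter_upwards [hν] with x hx
    rw [← lintegral_const_mul' _ _ hC]
    have hxy : ∀ᵐ y ∂μ, 1 ≤ C * ∫⁻ e in sphere (0 : E) 1, (∫⁻ t : ℝ, g (x - y + t • e))
        ∂μH[(finrank ℝ E : ℝ) - 1] := by
      filter_upwards [hμ] with y hy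
      rw [← hint, ← lintegral_add_left_eq_self g (x - y)]
      refine hle (fun z ↦ g (x - y + z)) (by fun_prop) fun z hz ↦ hg1 _ ?_
      have h1 : ‖z‖ ≤ ‖x - y + z‖ + ‖x - y‖ := by
        simpa using norm_sub_le (x - y + z) (x - y)
      have h2 : ‖x - y‖ ≤ ‖x‖ + ‖y‖ := norm_sub_le x y
      linarith
    simpa using lintegral_mono_ae hxy
  simpa using lintegral_mono_ae hone

end LineAverage

theorem msupport_eq_support {α : Type*} [TopologicalSpace α] [MeasurableSpace α] (ν : Measure α) :
    msupport ν = ν.support := by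
  ext x
  simp [msupport, Measure.mem_support_iff_forall, pos_iff_ne_zero]

theorem exists_ae_norm_le_of_isCompact_msupport {E : Type*} [NormedAddCommGroup E]
    [SecondCountableTopology E] [MeasurableSpace E] {ν : Measure E} (h : IsCompact (msupport ν)) :
    ∃ R : ℝ, ∀ᵐ x ∂ν, ‖x‖ ≤ R := by
  obtain ⟨R, hR⟩ := h.isBounded.exists_norm_le
  refine ⟨R, ?_⟩
  filter_upwards [Measure.support_mem_ae (μ := ν)] with x hx
  exact hR x (msupport_eq_support ν ▸ hx)

/-- Uniform lower bound for `‖f_δ‖_{L¹(σ^{n-1})}` (property (i) in the proof of the main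
theorem). -/
theorem lineAvg_L1_lower_bound (n : ℕ) (hn : 2 ≤ n)
    (ψ : EuclideanSpace ℝ (Fin n) → ℝ) (hψ_nonneg : ∀ x, 0 ≤ ψ x)
    (hψ_cont : Continuous ψ) (hψ_radial : ∀ x y, ‖x‖ = ‖y‖ → ψ x = ψ y)
    (hψ_supp : Function.support ψ ⊆ closedBall 0 1) (hψ_int : ∫ x, ψ x = 1)
    (μ ν : Measure (EuclideanSpace ℝ (Fin n)))
    [IsProbabilityMeasure μ] [IsProbabilityMeasure ν]
    (hμc : IsCompact (msupport μ)) (hνc : IsCompact (msupport ν))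
    (hdisj : Disjoint (msupport μ) (msupport ν)) :
    ∃ c : ℝ, 0 < c ∧ ∀ δ : ℝ, 0 < δ → δ < 1 →
      c ≤ ∫ e, lineAvg ψ μ ν δ e
            ∂(μH[(n : ℝ) - 1].restrict (sphere (0 : EuclideanSpace ℝ (Fin n)) 1)) := by
  have hn0 : 0 < n := by omega
  have : Nonempty (Fin n) := ⟨⟨0, hn0⟩⟩
  have : Nontrivial (EuclideanSpace ℝ (Fin n)) :=
    Module.nontrivial_of_finrank_pos (R := ℝ) (by simpa using hn0)
  obtain ⟨R₁, hR₁⟩ := exists_ae_norm_le_of_isCompact_msupport hμc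
  obtain ⟨R₂, hR₂⟩ := exists_ae_norm_le_of_isCompact_msupport hνc
  obtain ⟨C, hC, hlow⟩ := exists_le_lintegral_sphere_line volume μ ν (R := max R₁ R₂)
    (hR₁.mono fun _ h ↦ h.trans (le_max_left _ _)) (hR₂.mono fun _ h ↦ h.trans (le_max_right _ _))
  rw [finrank_euclideanSpace_fin] at hlow
  have hfinS : μH[(n : ℝ) - 1] (sphere (0 : EuclideanSpace ℝ (Fin n)) 1) < ∞ := by
    simpa using hausdorffMeasure_unitSphere_lt_top (E := EuclideanSpace ℝ (Fin n))
  have hcs : HasCompactSupport ψ :=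
    .of_support_subset_isCompact (isCompact_closedBall 0 1) hψ_supp
  obtain ⟨M, hM⟩ := hψ_cont.bounded_above_of_compact_support hcs
  refine ⟨(C + 1)⁻¹.toReal,
    ENNReal.toReal_pos (ENNReal.inv_ne_zero.2 (by simpa using hC)) (ENNReal.inv_ne_top.2 (by simp)),
    fun δ hδ hδ1 ↦ ?_⟩
  set φ : EuclideanSpace ℝ (Fin n) → ℝ := fun z ↦ (δ ^ n)⁻¹ * ψ (δ⁻¹ • z) with hφ
  have hφc : Continuous φ := by fun_prop
  have hφ0 : ∀ z, 0 ≤ φ z := fun z ↦ mul_nonneg (by positivity) (hψ_nonneg _)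
  have hφM : ∀ z, φ z ≤ (δ ^ n)⁻¹ * M := fun z ↦
    mul_le_mul_of_nonneg_left ((le_abs_self _).trans (hM _)) (by positivity)
  have hφδ : ∀ z, δ < ‖z‖ → φ z = 0 := by
    intro z hz
    have : ψ (δ⁻¹ • z) = 0 := by
      by_contra h
      have h1 := hψ_supp h
      rw [mem_closedBall_zero_iff, norm_smul, norm_inv, Real.norm_of_nonneg hδ.le,
        inv_mul_le_iff₀ hδ, mul_one] at h1
      exact h1.not_gt hz
    simp [hφ, this]
  have hφint : ∫ z, φ z = 1 := by
    rw [hφ, integral_const_mul, Measure.integral_comp_smul, finrank_euclideanSpace_fin, hψ_int,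
      abs_of_pos (by positivity)]
    field_simp
    simp
  have hφi : Integrable φ := .of_integral_ne_zero (by rw [hφint]; exact one_ne_zero)
  have hφl : ∫⁻ z, ENNReal.ofReal (φ z) = 1 := by
    rw [← ofReal_integral_eq_lintegral_ofReal hφi (.of_forall hφ0), hφint, ENNReal.ofReal_one]
  have hlow' := hlow (fun z ↦ ENNReal.ofReal (φ z)) (by fun_prop)
    (fun z hz ↦ by rw [hφδ z (hδ1.trans hz), ENNReal.ofReal_zero]) hφl
  set L : EuclideanSpace ℝ (Fin n) → ℝ≥0∞ := fun e ↦
    ∫⁻ x, (∫⁻ y, (∫⁻ t : ℝ, ENNReal.ofReal (φ (x - y + t • e))) ∂μ) ∂ν with hL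
  set B : ℝ≥0∞ := ENNReal.ofReal ((δ ^ n)⁻¹ * M) * ENNReal.ofReal (2 * δ) with hB
  have hBfin : B < ∞ := ENNReal.mul_lt_top ENNReal.ofReal_lt_top ENNReal.ofReal_lt_top
  have hLB : ∀ e ∈ sphere (0 : EuclideanSpace ℝ (Fin n)) 1, L e ≤ B := by
    intro e he
    calc L e ≤ ∫⁻ _, ∫⁻ _, B ∂μ ∂ν := lintegral_mono fun x ↦ lintegral_mono fun y ↦
          lintegral_line_le hφM hφδ _ (by simpa using he)
      _ = B := by simp
  have hLm : Measurable L := by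
    refine Measurable.lintegral_prod_right' (f := fun p : EuclideanSpace ℝ (Fin n) ×
      EuclideanSpace ℝ (Fin n) ↦
        ∫⁻ y, (∫⁻ t : ℝ, ENNReal.ofReal (φ (p.2 - y + t • p.1))) ∂μ) ?_
    refine Measurable.lintegral_prod_right' (f := fun p : (EuclideanSpace ℝ (Fin n) ×
      EuclideanSpace ℝ (Fin n)) × EuclideanSpace ℝ (Fin n) ↦
        ∫⁻ t : ℝ, ENNReal.ofReal (φ (p.1.2 - p.2 + t • p.1.1))) ?_
    exact Measurable.lintegral_prod_right' (f := fun p : ((EuclideanSpace ℝ (Fin n) ×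
      EuclideanSpace ℝ (Fin n)) × EuclideanSpace ℝ (Fin n)) × ℝ ↦
        ENNReal.ofReal (φ (p.1.1.2 - p.1.2 + p.2 • p.1.1.1))) (by fun_prop)
  have hmem : ∀ᵐ e ∂(μH[(n : ℝ) - 1].restrict (sphere (0 : EuclideanSpace ℝ (Fin n)) 1)),
      e ∈ sphere (0 : EuclideanSpace ℝ (Fin n)) 1 :=
    ae_restrict_mem isClosed_sphere.measurableSet
  have hint : ∫ e, lineAvg ψ μ ν δ e
      ∂(μH[(n : ℝ) - 1].restrict (sphere (0 : EuclideanSpace ℝ (Fin n)) 1)) =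
      (∫⁻ e in sphere (0 : EuclideanSpace ℝ (Fin n)) 1, L e ∂μH[(n : ℝ) - 1]).toReal := by
    rw [← integral_toReal hLm.aemeasurable (hmem.mono fun e he ↦ (hLB e he).trans_lt hBfin)]
    refine integral_congr_ae (hmem.mono fun e he ↦ ?_)
    exact integral_line_integral_eq_toReal hφc hφ0 hφM hφδ μ ν (by simpa using he)
  rw [hint]
  refine ENNReal.toReal_mono ?_ ?_
  · refine ((setLIntegral_mono' isClosed_sphere.measurableSet hLB).trans_lt ?_).ne
    rw [setLIntegral_const]
    exact ENNReal.mul_lt_top hBfin hfinS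
  · rw [ENNReal.inv_le_iff_le_mul (fun _ ↦ by simp) (fun h ↦ absurd h (by simpa using hC))]
    exact hlow'.trans (mul_le_mul_left le_self_add _)
end

section
/- Let n ≥ 2, let μ and ν be compactly supported Borel probability measures on ℝⁿ, and write B = spt μ. Let e ∈ S^{n−1} and let ν_e denote the pushforward of ν under the orthogonal projection π_{V_e} onto V_e = {e}ᗮ. Assume (a) ν({x ∈ ℝⁿ : (x + ℝe) ∩ B ≠ ∅}) = 0, and (b) there is a function g : V_e → [0,∞] such that for ν_e-almost every v ∈ V_e, ∫_ℝ μ_δ(v + t e) dt → g(v) as δ → 0. Then ∫ g dν_e = 0. -/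
open MeasureTheory Metric Set Filter
open scoped ENNReal NNReal Topology RealInnerProductSpace

/-- A measure on a hereditarily Lindelöf space is carried by its support. -/
lemma ae_mem_msupport {α : Type*} [TopologicalSpace α] [HereditarilyLindelofSpace α]
    [MeasurableSpace α] (μ : Measure α) : ∀ᵐ x ∂μ, x ∈ msupport μ := by
  have h : msupport μ = μ.support := by
    ext x
    rw [Measure.mem_support_iff_forall]
    exact forall₂_congr fun _ _ => pos_iff_ne_zero.symm
  rw [h]
  exact Measure.support_mem_ae

/-- If `z` is at distance more than `δ` from `spt μ`, then `μ_δ z = 0`. -/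
lemma mollified_eq_zero {n : ℕ} {ψ : EuclideanSpace ℝ (Fin n) → ℝ}
    (hψ : Function.support ψ ⊆ closedBall 0 1) (μ : Measure (EuclideanSpace ℝ (Fin n)))
    {δ : ℝ} (hδ : 0 < δ) {z : EuclideanSpace ℝ (Fin n)}
    (hz : ∀ y ∈ msupport μ, δ < dist z y) : mollified ψ μ δ z = 0 := by
  refine integral_eq_zero_of_ae ?_
  filter_upwards [ae_mem_msupport μ] with y hy
  suffices ψ (δ⁻¹ • (z - y)) = 0 by simp [this]
  by_contra h
  have h1 : δ⁻¹ * ‖z - y‖ ≤ 1 := by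
    simpa [norm_smul, abs_of_pos hδ] using hψ h
  rw [inv_mul_le_iff₀ hδ, mul_one, ← dist_eq_norm] at h1
  exact (hz y hy).not_ge h1

open scoped Pointwise in
/-- The union of the lines in direction `e` that meet a compact set is closed. -/
lemma isClosed_setOf_exists_add_smul_mem {E : Type*} [NormedAddCommGroup E] [NormedSpace ℝ E]
    {B : Set E} (hB : IsCompact B) (e : E) : IsClosed {x : E | ∃ t : ℝ, x + t • e ∈ B} := by
  have hcl : IsClosed ((Submodule.span ℝ {e} : Submodule ℝ E) : Set E) :=
    Submodule.closed_of_finiteDimensional _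
  have h : {x : E | ∃ t : ℝ, x + t • e ∈ B} =
      ((Submodule.span ℝ {e} : Submodule ℝ E) : Set E) + B := by
    ext x
    simp only [Set.mem_add, SetLike.mem_coe, Submodule.mem_span_singleton, mem_ofPred_eq]
    constructor
    · rintro ⟨t, ht⟩
      exact ⟨-(t • e), ⟨-t, neg_smul t e⟩, _, ht, by abel⟩
    · rintro ⟨_, ⟨t, rfl⟩, b, hb, rfl⟩
      exact ⟨-t, by simpa [add_right_comm] using hb⟩
  rw [h]
  exact hcl.add_right_of_isCompact hB

/-- A line that misses a compact set stays at positive distance from it. -/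
lemma exists_pos_lt_dist_add_smul {E : Type*} [NormedAddCommGroup E] [NormedSpace ℝ E]
    {B : Set E} (hB : IsCompact B) {v e : E} (hv : ∀ t : ℝ, v + t • e ∉ B) :
    ∃ r > 0, ∀ t : ℝ, ∀ y ∈ B, r < dist (v + t • e) y := by
  have hcl : IsClosed {x : E | ∃ t : ℝ, x + t • e ∈ ({v} : Set E)} :=
    isClosed_setOf_exists_add_smul_mem isCompact_singleton e
  have hd : Disjoint B {x : E | ∃ t : ℝ, x + t • e ∈ ({v} : Set E)} := by
    rw [Set.disjoint_left]
    rintro x hx ⟨t, ht⟩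
    rw [mem_singleton_iff] at ht
    exact hv (-t) (by simpa [← ht] using hx)
  obtain ⟨r, hr, h⟩ := Metric.exists_pos_forall_lt_edist hB hcl hd
  refine ⟨r, hr, fun t y hy => ?_⟩
  have h1 := h y hy (v + t • e) ⟨-t, by simp⟩
  rw [edist_comm, edist_nndist] at h1
  exact_mod_cast h1

/-- If `ν`-a.e. line in direction `e` misses `B = spt μ`, and the line integrals of `μ_δ`
converge `ν_e`-a.e. to a function `g`, then `∫ g dν_e = 0`. -/
theorem limit_lineIntegral_null (n : ℕ) (hn : 2 ≤ n)
    (ψ : EuclideanSpace ℝ (Fin n) → ℝ) (hψ_nonneg : ∀ x, 0 ≤ ψ x)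
    (hψ_cont : Continuous ψ) (hψ_radial : ∀ x y, ‖x‖ = ‖y‖ → ψ x = ψ y)
    (hψ_supp : Function.support ψ ⊆ closedBall 0 1) (hψ_int : ∫ x, ψ x = 1)
    (μ ν : Measure (EuclideanSpace ℝ (Fin n)))
    [IsProbabilityMeasure μ] [IsProbabilityMeasure ν]
    (hμc : IsCompact (msupport μ)) (hνc : IsCompact (msupport ν))
    (e : EuclideanSpace ℝ (Fin n)) (he : e ∈ sphere (0 : EuclideanSpace ℝ (Fin n)) 1)
    (hlines : ν {x : EuclideanSpace ℝ (Fin n) | ∃ t : ℝ, x + t • e ∈ msupport μ} = 0)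
    (g : EuclideanSpace ℝ (Fin n) → ℝ≥0∞)
    (hconv : ∀ᵐ v ∂(Measure.map (fun x => x - ⟪x, e⟫ • e) ν),
      Tendsto (fun δ : ℝ => ENNReal.ofReal (∫ t : ℝ, mollified ψ μ δ (v + t • e)))
        (𝓝[>] 0) (𝓝 (g v))) :
    ∫⁻ v, g v ∂(Measure.map (fun x => x - ⟪x, e⟫ • e) ν) = 0 := by
  have hP : Measurable fun x : EuclideanSpace ℝ (Fin n) => x - ⟪x, e⟫ • e := by
    fun_prop
  have hmiss : ∀ᵐ v ∂(Measure.map (fun x => x - ⟪x, e⟫ • e) ν),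
      ¬ ∃ t : ℝ, v + t • e ∈ msupport μ := by
    refine (ae_map_iff hP.aemeasurable
      (isClosed_setOf_exists_add_smul_mem hμc e).measurableSet.compl).mpr ?_
    filter_upwards [measure_eq_zero_iff_ae_notMem.mp hlines] with x hx ⟨t, ht⟩
    exact hx ⟨t - ⟪x, e⟫, by convert ht using 1; module⟩
  refine lintegral_eq_zero_of_ae_eq_zero ?_
  filter_upwards [hconv, hmiss] with v hv hline
  obtain ⟨r, hr, hdist⟩ := exists_pos_lt_dist_add_smul hμc (not_exists.mp hline)
  refine tendsto_nhds_unique hv (tendsto_const_nhds.congr' ?_)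
  filter_upwards [Ioo_mem_nhdsGT hr] with δ hδ
  simp [mollified_eq_zero hψ_supp μ hδ.1 fun y hy => hδ.2.trans (hdist _ y hy)]
end

section
/- Let n ≥ 2, let K ⊆ ℝⁿ be a compact set with K ∩ {x : x_n = 0} = ∅, and let a ∈ ℝ^{n−1}. Let V ⊂ ℝⁿ be the hyperplane orthogonal to the vector (a, 1), and suppose H^{n−1}(π_V(K)) = 0, where π_V is the orthogonal projection onto V. Let F(x̃, x_n) = (x̃/x_n, 1/x_n) on {x_n ≠ 0}. Then the radial projection of F(K) from the base point (a, 0) is H^{n−1}-null: H^{n−1}(π_{(a,0)}(F(K))) = 0. -/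
open MeasureTheory Metric Set
open scoped ENNReal NNReal RealInnerProductSpace

/-- Normalization `x ↦ x / ‖x‖` is `2`-Lipschitz outside the open unit ball. -/
theorem lipschitzOnWith_inv_norm_smul {E : Type*} [NormedAddCommGroup E] [NormedSpace ℝ E] :
    LipschitzOnWith 2 (fun x : E => ‖x‖⁻¹ • x) {x | 1 ≤ ‖x‖} := by
  refine LipschitzOnWith.of_dist_le_mul fun x (hx : 1 ≤ ‖x‖) y (hy : 1 ≤ ‖y‖) => ?_
  have hx0 : 0 < ‖x‖ := by linarith
  have hy0 : 0 < ‖y‖ := by linarith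
  have hsplit : ‖x‖⁻¹ • x - ‖y‖⁻¹ • y = ‖x‖⁻¹ • (x - y) + (‖x‖⁻¹ - ‖y‖⁻¹) • y := by
    module
  have hfst : ‖‖x‖⁻¹ • (x - y)‖ ≤ ‖x - y‖ := by
    rw [norm_smul, norm_inv, norm_norm]
    exact mul_le_of_le_one_left (norm_nonneg _) (inv_le_one_of_one_le₀ hx)
  have hsnd : ‖(‖x‖⁻¹ - ‖y‖⁻¹) • y‖ ≤ ‖x - y‖ := by
    have hrw : (‖x‖⁻¹ - ‖y‖⁻¹) * ‖y‖ = ‖x‖⁻¹ * (‖y‖ - ‖x‖) := by field_simp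
    calc ‖(‖x‖⁻¹ - ‖y‖⁻¹) • y‖ = |‖x‖⁻¹ * (‖y‖ - ‖x‖)| := by
          rw [norm_smul, Real.norm_eq_abs, ← hrw, abs_mul, abs_norm]
      _ = ‖x‖⁻¹ * |‖y‖ - ‖x‖| := by rw [abs_mul, abs_of_pos (inv_pos.2 hx0)]
      _ ≤ |‖y‖ - ‖x‖| := mul_le_of_le_one_left (abs_nonneg _) (inv_le_one_of_one_le₀ hx)
      _ ≤ ‖x - y‖ := by rw [norm_sub_rev x y]; exact abs_norm_sub_norm_le y x
  rw [dist_eq_norm, dist_eq_norm, hsplit, NNReal.coe_ofNat]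
  linarith [norm_add_le (‖x‖⁻¹ • (x - y)) ((‖x‖⁻¹ - ‖y‖⁻¹) • y)]

/-- A Lipschitz function maps `μH[d]`-null sets to `μH[d]`-null sets. -/
theorem LipschitzWith.hausdorffMeasure_image_eq_zero {X Y : Type*} [EMetricSpace X]
    [EMetricSpace Y] [MeasurableSpace X] [BorelSpace X] [MeasurableSpace Y] [BorelSpace Y]
    {C : ℝ≥0} {f : X → Y} (hf : LipschitzWith C f) {d : ℝ} (hd : 0 ≤ d) {s : Set X}
    (hs : μH[d] s = 0) : μH[d] (f '' s) = 0 :=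
  le_antisymm ((hf.hausdorffMeasure_image_le hd s).trans (by simp [hs])) zero_le

/-- The projection along `w` onto the hyperplane of vectors with vanishing last coordinate,
followed by translation by the last basis vector `e` and normalization. -/
noncomputable def shearedDirection {n : ℕ} (w x : EuclideanSpace ℝ (Fin (n + 1))) :
    EuclideanSpace ℝ (Fin (n + 1)) :=
  ‖x - x (Fin.last n) • w + EuclideanSpace.single (Fin.last n) 1‖⁻¹ •
    (x - x (Fin.last n) • w + EuclideanSpace.single (Fin.last n) 1)

theorem exists_lipschitzWith_shearedDirection {n : ℕ} {w : EuclideanSpace ℝ (Fin (n + 1))}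
    (hw : w (Fin.last n) = 1) : ∃ C, LipschitzWith C (shearedDirection w) := by
  let L : EuclideanSpace ℝ (Fin (n + 1)) →L[ℝ] EuclideanSpace ℝ (Fin (n + 1)) :=
    ContinuousLinearMap.id ℝ _ - (EuclideanSpace.proj (Fin.last n)).smulRight w
  have hT := L.lipschitz.add
    (LipschitzWith.const (EuclideanSpace.single (Fin.last n) (1 : ℝ)))
  refine ⟨_, lipschitzOnWith_univ.1
    (lipschitzOnWith_inv_norm_smul.comp (lipschitzOnWith_univ.2 hT) fun x _ => ?_)⟩
  refine le_trans ?_ (PiLp.norm_apply_le _ (Fin.last n))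
  simp [hw]

theorem shearedDirection_sub_smul {n : ℕ} {w : EuclideanSpace ℝ (Fin (n + 1))}
    (hw : w (Fin.last n) = 1) (x : EuclideanSpace ℝ (Fin (n + 1))) (t : ℝ) :
    shearedDirection w (x - t • w) = shearedDirection w x := by
  have h : x - t • w - (x - t • w) (Fin.last n) • w = x - x (Fin.last n) • w := by
    simp only [PiLp.sub_apply, PiLp.smul_apply, hw, smul_eq_mul, mul_one]
    module
  rw [shearedDirection, shearedDirection, h]

/-- Seen from `a`, the projective image of `x` lies in the direction `± shearedDirection w x`
with `w = a + e`. -/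
theorem normalize_projective_sub {n : ℕ} (a : EuclideanSpace ℝ (Fin (n + 1)))
    {x : EuclideanSpace ℝ (Fin (n + 1))} (hx : x (Fin.last n) ≠ 0) :
    let e : EuclideanSpace ℝ (Fin (n + 1)) := EuclideanSpace.single (Fin.last n) 1
    let y := (x (Fin.last n))⁻¹ • (x + (1 - x (Fin.last n)) • e)
    ‖y - a‖⁻¹ • (y - a) = shearedDirection (a + e) x ∨
      ‖y - a‖⁻¹ • (y - a) = -shearedDirection (a + e) x := by
  intro e y
  have hy : y - a = (x (Fin.last n))⁻¹ • (x - x (Fin.last n) • (a + e) + e) := by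
    rw [eq_inv_smul_iff₀ hx, smul_sub, smul_inv_smul₀ hx]
    module
  rw [hy, norm_smul, shearedDirection, norm_inv, Real.norm_eq_abs, mul_inv, inv_inv, smul_smul]
  rcases hx.lt_or_gt with h | h
  · right
    rw [abs_of_neg h, ← neg_smul]
    congr 1
    field_simp
    rfl
  · left
    rw [abs_of_pos h]
    congr 1
    field_simp
    rfl

/-- If `K ⊂ ℝ^{n+1}` is compact, avoids the hyperplane `{xₙ₊₁ = 0}`, and projects to an
`H^n`-null set under the orthogonal projection onto the hyperplane `V` orthogonal to `(a, 1)`,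
then the image `F(K)` under the projective transformation `F(x̃, xₙ₊₁) = (x̃/xₙ₊₁, 1/xₙ₊₁)`
has `H^n`-null radial projection from the base point `(a, 0)`.
(Here the ambient space `ℝⁿ` of the paper, `n ≥ 2`, is formalised as `ℝ^{n+1}` with `n ≥ 1`;
the last coordinate plays the role of `xₙ`, the point `(a, 0)` is `a`, and `(a, 1)` is
`a + eₙ₊₁`.) -/
theorem radialProj_null_of_orthProj_null (n : ℕ) (hn : 1 ≤ n)
    (K : Set (EuclideanSpace ℝ (Fin (n + 1)))) (hK : IsCompact K)
    (hK0 : ∀ x ∈ K, x (Fin.last n) ≠ 0)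
    (a : EuclideanSpace ℝ (Fin (n + 1))) (ha : a (Fin.last n) = 0)
    -- `w = (a, 1)`; the hyperplane `V` is `{w}ᗮ`, and `π_V` is the orthogonal projection:
    (hproj : μH[(n : ℝ)]
      ((fun x : EuclideanSpace ℝ (Fin (n + 1)) =>
          x - (⟪x, a + EuclideanSpace.single (Fin.last n) 1⟫ /
              ‖a + EuclideanSpace.single (Fin.last n) 1‖ ^ 2) •
            (a + EuclideanSpace.single (Fin.last n) 1)) '' K) = 0) :
    μH[(n : ℝ)]
      ((fun y : EuclideanSpace ℝ (Fin (n + 1)) => ‖y - a‖⁻¹ • (y - a)) ''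
        (((fun x : EuclideanSpace ℝ (Fin (n + 1)) =>
            (x (Fin.last n))⁻¹ •
              (x + (1 - x (Fin.last n)) • EuclideanSpace.single (Fin.last n) 1)) '' K)
          \ {a})) = 0 := by
  have hw : (a + EuclideanSpace.single (Fin.last n) (1 : ℝ)) (Fin.last n) = 1 := by simp [ha]
  obtain ⟨C, hC⟩ := exists_lipschitzWith_shearedDirection hw
  have hpos := hC.hausdorffMeasure_image_eq_zero n.cast_nonneg hproj
  have hneg := hC.neg.hausdorffMeasure_image_eq_zero n.cast_nonneg hproj
  refine measure_mono_null ?_ (measure_union_null hpos hneg)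
  rintro _ ⟨_, ⟨⟨x, hx, rfl⟩, -⟩, rfl⟩
  rcases normalize_projective_sub a (hK0 x hx) with h | h
  · exact Or.inl ⟨_, ⟨x, hx, rfl⟩, (shearedDirection_sub_smul hw x _).trans h.symm⟩
  · exact Or.inr ⟨_, ⟨x, hx, rfl⟩,
      (congrArg Neg.neg (shearedDirection_sub_smul hw x _)).trans h.symm⟩
end

section
/- Let n ≥ 2 and let B ⊆ ℝⁿ be a Borel set with 0 < H^{n−1}(B) < ∞ which is purely (n − 1)-unrectifiable, i.e. H^{n−1}(B ∩ f(ℝ^{n−1})) = 0 for every Lipschitz map f : ℝ^{n−1} → ℝⁿ. Then for Lebesgue-almost every x ∈ ℝⁿ, H^{n−1}(π_x(B \ {x})) = 0. -/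
open MeasureTheory Metric Set
open scoped ENNReal NNReal

/-- The radial projection with base point `x`, applied to the set `B`:
`π_x(B) = {(y - x)/‖y - x‖ : y ∈ B \ {x}}`. -/
noncomputable def radialProj {n : ℕ} (x : EuclideanSpace ℝ (Fin n))
    (B : Set (EuclideanSpace ℝ (Fin n))) : Set (EuclideanSpace ℝ (Fin n)) :=
  (fun y => ‖y - x‖⁻¹ • (y - x)) '' (B \ {x})

open Filter Topology

section Covering

variable {m : ℕ}

/-- A Vitali covering bound for an outer measure on `ℝᵐ`. -/
lemma outerMeasure_iUnion_closedBall_le {ι : Type*} (Φ : OuterMeasure (Fin m → ℝ)) (T : Set ι)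
    (c : ι → Fin m → ℝ) (ρ : ι → ℝ) (R : ℝ) (hR : ∀ i ∈ T, ρ i ≤ R) (hρ : ∀ i ∈ T, 0 < ρ i)
    (U : Set (Fin m → ℝ)) (hU : ∀ i ∈ T, closedBall (c i) (ρ i) ⊆ U) (κ : ℝ≥0∞)
    (hΦ : ∀ i ∈ T, Φ (closedBall (c i) (5 * ρ i)) ≤ κ * volume (closedBall (c i) (ρ i))) :
    Φ (⋃ i ∈ T, closedBall (c i) (ρ i)) ≤ κ * volume U := by
  obtain ⟨u, huT, hdisj, hcov⟩ :=
    Vitali.exists_disjoint_subfamily_covering_enlargement_closedBall T c ρ R hR 5 (by norm_num)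
  have hcount : u.Countable := by
    refine hdisj.countable_of_nonempty_interior fun i hi => ?_
    exact ⟨c i, ball_subset_interior_closedBall (mem_ball_self (hρ i (huT hi)))⟩
  calc Φ (⋃ i ∈ T, closedBall (c i) (ρ i))
      ≤ Φ (⋃ i ∈ u, closedBall (c i) (5 * ρ i)) := by
        refine measure_mono (iUnion₂_subset fun i hi => ?_)
        obtain ⟨j, hj, hij⟩ := hcov i hi
        exact hij.trans (subset_biUnion_of_mem (u := fun j => closedBall (c j) (5 * ρ j)) hj)
    _ ≤ ∑' i : u, Φ (closedBall (c i) (5 * ρ i)) := measure_biUnion_le Φ hcount _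
    _ ≤ ∑' i : u, κ * volume (closedBall (c i) (ρ i)) :=
        ENNReal.tsum_le_tsum fun i => hΦ i (huT i.2)
    _ = κ * volume (⋃ i ∈ u, closedBall (c i) (ρ i)) := by
        rw [ENNReal.tsum_mul_left,
          measure_biUnion hcount hdisj fun i _ => isClosed_closedBall.measurableSet]
    _ ≤ κ * volume U := by
        gcongr
        exact iUnion₂_subset fun i hi => hU i (huT hi)

lemma volume_closedBall_pi (w : Fin m → ℝ) {r : ℝ} (hr : 0 ≤ r) :
    volume (closedBall w r) = ENNReal.ofReal ((2 * r) ^ m) := by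
  simpa using Real.volume_pi_closedBall w hr

lemma ofReal_mul_pow {a b : ℝ} (ha : 0 ≤ a) :
    ENNReal.ofReal ((a * b) ^ m) = ENNReal.ofReal (a ^ m) * ENNReal.ofReal (b ^ m) := by
  rw [mul_pow, ENNReal.ofReal_mul (by positivity)]

/-- An outer measure vanishing on a closed set `F` and having bounded `m`-dimensional density
at the points of `F` has zero density at almost all points of `F`. -/
lemma ae_restrict_density_zero (Φ : OuterMeasure (Fin m → ℝ)) {F : Set (Fin m → ℝ)}
    (hF : IsClosed F) (hΦF : Φ F = 0) {M : ℝ≥0∞} (hM : M ≠ ∞) {s₀ : ℝ} (hs₀ : 0 < s₀)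
    (h : ∀ v ∈ F, ∀ q : ℚ, 0 < (q : ℝ) → q < s₀ →
      Φ (closedBall v q) ≤ M * ENNReal.ofReal ((q : ℝ) ^ m)) :
    ∀ᵐ v ∂volume.restrict F, ∀ ε : ℝ≥0∞, ε ≠ 0 →
      ∀ᶠ s in 𝓝[>] (0 : ℝ), Φ (closedBall v s) ≤ ε * ENNReal.ofReal (s ^ m) := by
  rw [ae_restrict_iff' hF.measurableSet]
  filter_upwards [Besicovitch.ae_tendsto_measure_inter_div_of_measurableSet
    (volume : Measure (Fin m → ℝ)) hF.measurableSet.compl] with v hv hvF ε hε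
  rw [indicator_of_notMem (by simpa using hvF)] at hv
  set κ : ℝ≥0∞ := M * ENNReal.ofReal (30 ^ m) with hκ
  have hκtop : κ * ENNReal.ofReal (4 ^ m) ≠ ∞ := by finiteness
  obtain ⟨ε', hε', hle⟩ : ∃ ε' : ℝ≥0∞, 0 < ε' ∧ κ * ENNReal.ofReal (4 ^ m) * ε' ≤ ε := by
    refine ⟨ε / (κ * ENNReal.ofReal (4 ^ m)), ENNReal.div_pos hε hκtop, ENNReal.mul_div_le⟩
  have hev : ∀ᶠ r in 𝓝[>] (0 : ℝ), volume (Fᶜ ∩ closedBall v r) / volume (closedBall v r) < ε' :=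
    hv.eventually (gt_mem_nhds hε')
  have h2 : Tendsto (fun s : ℝ => 2 * s) (𝓝[>] 0) (𝓝[>] 0) := by
    refine tendsto_nhdsWithin_iff.2 ⟨?_, ?_⟩
    · exact ((continuous_const.mul continuous_id).tendsto' (0 : ℝ) 0 (by simp)).mono_left
        nhdsWithin_le_nhds
    · filter_upwards [self_mem_nhdsWithin] with s hs
      simpa using hs
  filter_upwards [h2.eventually hev, self_mem_nhdsWithin,
    mem_nhdsWithin_of_mem_nhds (gt_mem_nhds (show (0 : ℝ) < s₀ / 6 by positivity))]
    with s hs hs0 hss₀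
  have hs0 : 0 < s := hs0
  have hvol : volume (Fᶜ ∩ closedBall v (2 * s)) ≤ ε' * ENNReal.ofReal ((4 * s) ^ m) := by
    have := (ENNReal.div_le_iff (measure_closedBall_pos volume v (by positivity)).ne'
      measure_closedBall_lt_top.ne).1 hs.le
    rwa [volume_closedBall_pi v (by positivity), ← mul_assoc, show (2 : ℝ) * 2 = 4 by norm_num]
      at this
  have hcov : Φ (closedBall v s \ F) ≤ κ * volume (Fᶜ ∩ closedBall v (2 * s)) := by
    have hd : ∀ w ∈ closedBall v s \ F, 0 < infDist w F ∧ infDist w F ≤ s := fun w hw =>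
      ⟨(hF.notMem_iff_infDist_pos ⟨v, hvF⟩).1 hw.2, (infDist_le_dist_of_mem hvF).trans hw.1⟩
    refine le_trans (measure_mono (fun w hw => ?_)) (outerMeasure_iUnion_closedBall_le Φ
      (closedBall v s \ F) id (fun w => infDist w F / 10) s (fun w hw => ?_) (fun w hw => ?_)
      _ (fun w hw => ?_) κ (fun w hw => ?_))
    · exact mem_biUnion hw (mem_closedBall_self (by have := (hd w hw).1; positivity))
    · linarith [hd w hw]
    · linarith [hd w hw]
    · obtain ⟨h0, h1⟩ := hd w hw
      intro y hy
      simp only [id, mem_closedBall] at hy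
      refine ⟨fun hyF => ?_, ?_⟩
      · have := infDist_le_dist_of_mem (x := w) hyF
        rw [dist_comm] at this
        linarith
      · have := dist_triangle y w v
        have h3 : dist w v ≤ s := hw.1
        simp only [mem_closedBall]
        linarith
    · obtain ⟨h0, h1⟩ := hd w hw
      simp only [id]
      set d := infDist w F
      obtain ⟨z, hzF, hz⟩ := (infDist_lt_iff (x := w) ⟨v, hvF⟩).1 (show infDist w F < 2 * d by
        change d < 2 * d; linarith)
      obtain ⟨q, hq1, hq2⟩ := exists_rat_btwn (show 3 * d < 6 * d by linarith)
      calc Φ (closedBall w (5 * (d / 10))) ≤ Φ (closedBall z q) := by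
            refine measure_mono (closedBall_subset_closedBall' ?_)
            linarith
        _ ≤ M * ENNReal.ofReal ((q : ℝ) ^ m) := h z hzF q (by linarith) (by linarith)
        _ ≤ M * ENNReal.ofReal ((30 * (2 * (d / 10))) ^ m) := by
            gcongr
            · linarith
            · linarith
        _ = κ * volume (closedBall w (d / 10)) := by
            rw [volume_closedBall_pi w (by positivity), ofReal_mul_pow (by norm_num), hκ, mul_assoc]
  calc Φ (closedBall v s) ≤ Φ (F ∪ closedBall v s \ F) := by
        refine measure_mono ?_
        rw [union_sdiff_self]
        exact subset_union_right
    _ ≤ Φ F + Φ (closedBall v s \ F) := measure_union_le _ _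
    _ ≤ κ * (ε' * ENNReal.ofReal ((4 * s) ^ m)) := by
        rw [hΦF, zero_add]
        exact hcov.trans (by gcongr)
    _ = κ * ENNReal.ofReal (4 ^ m) * ε' * ENNReal.ofReal (s ^ m) := by
        rw [ofReal_mul_pow (by norm_num)]; ring
    _ ≤ ε * ENNReal.ofReal (s ^ m) := by gcongr

/-- The points of infinite upper `m`-dimensional density of a finite measure on `ℝᵐ` form a
null set. -/
lemma volume_infinite_density_eq_zero (ν : Measure (Fin m → ℝ)) [IsFiniteMeasure ν] :
    volume {w : Fin m → ℝ | ∀ M : ℕ, ∀ η > 0, ∃ ρ : ℝ, 0 < ρ ∧ ρ < η ∧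
      M * ENNReal.ofReal (ρ ^ m) < ν (closedBall w ρ)} = 0 := by
  have h := (Besicovitch.ae_tendsto_rnDeriv ν (volume : Measure (Fin m → ℝ))).and
    (Measure.rnDeriv_lt_top ν volume)
  refine measure_mono_null (fun w hw => ?_) (ae_iff.1 h)
  rintro ⟨hlim, hfin⟩
  obtain ⟨M, hM⟩ := ENNReal.exists_nat_gt hfin.ne
  have hev := hlim.eventually (gt_mem_nhds hM)
  rw [eventually_nhdsWithin_iff, Metric.eventually_nhds_iff] at hev
  obtain ⟨η, hη, hev⟩ := hev
  obtain ⟨k, hk⟩ : ∃ k : ℕ, (M : ℝ≥0∞) * ENNReal.ofReal (2 ^ m) ≤ k := by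
    obtain ⟨k, hk⟩ := ENNReal.exists_nat_gt (show (M : ℝ≥0∞) * ENNReal.ofReal (2 ^ m) ≠ ∞ by
      finiteness)
    exact ⟨k, hk.le⟩
  obtain ⟨ρ, hρ, hρη, hlt⟩ := hw k η hη
  have h1 := hev (y := ρ) (by simpa [abs_of_pos hρ] using hρη) hρ
  have h2 := (ENNReal.div_le_iff (measure_closedBall_pos volume w hρ).ne'
      measure_closedBall_lt_top.ne).1 h1.le
  rw [volume_closedBall_pi w hρ.le, ofReal_mul_pow (by norm_num), ← mul_assoc] at h2
  exact absurd (hlt.trans_le h2) (not_lt.2 (by gcongr))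

end Covering

section Projections

variable {m : ℕ} {X : Type*} [MeasurableSpace X]

/-- If all the double cones of aperture `s` at the points of `A` have small mass and `A` has no
subset of positive measure on which `t` is a Lipschitz function of `P`, then `A` has small
measure. -/
lemma measure_le_of_cone_measure_le (μ : Measure X) (P : X → Fin m → ℝ) (t : X → ℝ) {A : Set X}
    {s δ R : ℝ} (c : Fin m → ℝ) (l : ℝ≥0∞) (hs : 0 < s) (hs1 : s ≤ 1) (hδ : 0 < δ)
    (hcone : ∀ x ∈ A, ∀ r : ℚ, 0 < (r : ℝ) → r < δ →
      μ {b | 0 < |t b - t x| ∧ |t b - t x| < r ∧ dist (P b) (P x) ≤ s * |t b - t x|}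
        ≤ l * ENNReal.ofReal ((r * s) ^ m))
    (hdiam : ∀ x ∈ A, ∀ y ∈ A, |t y - t x| ≤ δ / 8)
    (hP : ∀ x ∈ A, P x ∈ closedBall c R)
    (hnull : ∀ G ⊆ A, (∀ x ∈ G, ∀ y ∈ G, s / 4 * |t y - t x| ≤ dist (P y) (P x)) → μ G = 0) :
    μ A ≤ 2 * ENNReal.ofReal (40 ^ m) * l * volume (closedBall c (R + δ)) := by
  set H : X → Set ℝ := fun x =>
    {d | ∃ y ∈ A, dist (P y) (P x) < s / 4 * |t y - t x| ∧ |t y - t x| = d}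
  set A' : Set X := {x ∈ A | (H x).Nonempty}
  have hG : μ (A \ A') = 0 := by
    refine hnull _ sdiff_subset fun x hx y hy => ?_
    by_contra! hlt
    exact hx.2 ⟨hx.1, _, y, hy.1, hlt, rfl⟩
  set h : X → ℝ := fun x => sSup (H x)
  have hbdd : ∀ x ∈ A, BddAbove (H x) := by
    rintro x hx
    refine ⟨δ / 8, ?_⟩
    rintro d ⟨y, hy, -, rfl⟩
    exact hdiam x hx y hy
  have hpos : ∀ x ∈ A', 0 < h x := by
    rintro x ⟨hx, d, hd⟩
    refine lt_of_lt_of_le ?_ (le_csSup (hbdd x hx) hd)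
    obtain ⟨y, hy, hlt, rfl⟩ := hd
    have := dist_nonneg.trans_lt hlt
    exact pos_of_mul_pos_right this (by positivity)
  have hle : ∀ x ∈ A', h x ≤ δ / 8 := by
    rintro x ⟨hx, hne⟩
    refine csSup_le hne ?_
    rintro d ⟨y, hy, -, rfl⟩
    exact hdiam x hx y hy
  set Φ : OuterMeasure (Fin m → ℝ) :=
    OuterMeasure.map P (OuterMeasure.restrict A μ.toOuterMeasure) with hΦ
  have hΦapply : ∀ S, Φ S = μ (P ⁻¹' S ∩ A) := fun S => by
    simp [hΦ]
  have key : ∀ x ∈ A', Φ (closedBall (P x) (5 * (s * h x / 20))) ≤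
      2 * ENNReal.ofReal (40 ^ m) * l * volume (closedBall (P x) (s * h x / 20)) := by
    intro x hx
    have h0 := hpos x hx
    obtain ⟨d, ⟨y, hyA, hy, rfl⟩, hyd⟩ :=
      exists_lt_of_lt_csSup hx.2 (show 3 / 4 * h x < h x by linarith)
    have hyh : |t y - t x| ≤ h x := le_csSup (hbdd x hx.1) ⟨y, hyA, hy, rfl⟩
    obtain ⟨r, hr1, hr2⟩ := exists_rat_btwn (show 2 * h x < 4 * h x by linarith)
    have hrδ : (r : ℝ) < δ := by linarith [hle x hx]
    have hr0 : (0 : ℝ) < r := by linarith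
    have hsub : P ⁻¹' closedBall (P x) (5 * (s * h x / 20)) ∩ A ⊆
        {b | 0 < |t b - t x| ∧ |t b - t x| < r ∧ dist (P b) (P x) ≤ s * |t b - t x|} ∪
        {b | 0 < |t b - t y| ∧ |t b - t y| < r ∧ dist (P b) (P y) ≤ s * |t b - t y|} := by
      rintro z ⟨hzP, hzA⟩
      have hzP : dist (P z) (P x) ≤ s * (h x / 4) := by
        have : dist (P z) (P x) ≤ 5 * (s * h x / 20) := hzP
        linarith
      have hzh : |t z - t x| ≤ h x := by
        by_contra! hlt
        refine hlt.not_ge (le_csSup (hbdd x hx.1) ⟨z, hzA, hzP.trans_lt ?_, rfl⟩)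
        rw [div_mul_eq_mul_div, mul_div_assoc]
        gcongr
      rcases le_or_gt (h x / 4) |t z - t x| with hz | hz
      · left
        exact ⟨by linarith, by linarith, hzP.trans (by gcongr)⟩
      · right
        have h1 : h x / 2 ≤ |t z - t y| := by
          have := abs_sub_le (t y) (t z) (t x)
          rw [abs_sub_comm (t y) (t z)] at this
          linarith
        have h2 : |t z - t y| < r := by
          have := abs_sub_le (t z) (t x) (t y)
          rw [abs_sub_comm (t x) (t y)] at this
          linarith
        refine ⟨by linarith, h2, ?_⟩
        have h3 := dist_triangle_right (P z) (P y) (P x)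
        have h4 : s / 4 * |t y - t x| ≤ s / 4 * h x := by gcongr
        calc dist (P z) (P y) ≤ s * (h x / 2) := by linarith
          _ ≤ s * |t z - t y| := by gcongr
    rw [hΦapply]
    calc μ (P ⁻¹' closedBall (P x) (5 * (s * h x / 20)) ∩ A)
        ≤ l * ENNReal.ofReal ((r * s) ^ m) + l * ENNReal.ofReal ((r * s) ^ m) :=
          (measure_mono hsub).trans ((measure_union_le _ _).trans
            (add_le_add (hcone x hx.1 r hr0 hrδ) (hcone y hyA r hr0 hrδ)))
      _ ≤ 2 * l * ENNReal.ofReal ((40 * (2 * (s * h x / 20))) ^ m) := by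
          rw [← two_mul, ← mul_assoc]
          refine mul_le_mul' le_rfl (ENNReal.ofReal_le_ofReal
            (pow_le_pow_left₀ (by positivity) ?_ m))
          nlinarith
      _ = _ := by
          rw [volume_closedBall_pi _ (by positivity), ofReal_mul_pow (by norm_num)]
          ring
  have hA'le : μ A' ≤ 2 * ENNReal.ofReal (40 ^ m) * l * volume (closedBall c (R + δ)) := by
    refine le_trans ?_ (outerMeasure_iUnion_closedBall_le Φ A' P (fun x => s * h x / 20) δ
      (fun x hx => ?_) (fun x hx => ?_) _ (fun x hx => ?_) _ key)
    · rw [hΦapply]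
      refine measure_mono fun x hx => ⟨mem_biUnion hx (mem_closedBall_self ?_), hx.1⟩
      have := hpos x hx
      positivity
    · have h0 := hpos x hx
      have := hle x hx
      nlinarith
    · have := hpos x hx
      positivity
    · refine closedBall_subset_closedBall' ?_
      have h0 := hpos x hx
      have := hle x hx
      have h3 : dist (P x) c ≤ R := hP x hx.1
      nlinarith
  calc μ A ≤ μ (A' ∪ A \ A') := by rw [union_sdiff_self]; exact measure_mono subset_union_right
    _ ≤ μ A' + μ (A \ A') := measure_union_le _ _
    _ ≤ _ := by rw [hG, add_zero]; exact hA'le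

/-- If `P` does not increase measure by more than a constant factor, almost every fibre of `P` has
a finite image under `t`. -/
lemma volume_infinite_fibre_eq_zero (μ : Measure X) [IsFiniteMeasure μ] (P : X → Fin m → ℝ)
    {t : X → ℝ} (ht : Measurable t) (K : Set X) {C : ℝ≥0∞} (hC : C ≠ ∞)
    (hP : ∀ S, MeasurableSet S → volume (P '' (K ∩ S)) ≤ C * μ S) :
    volume {w | (t '' {x ∈ K | P x = w}).Infinite} = 0 := by
  set S : ℕ → ℤ → Set X := fun j k => {x | ⌊t x * 2 ^ j⌋ = k}
  have hSm : ∀ j k, MeasurableSet (S j k) := fun j k =>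
    measurableSet_eq_fun (ht.mul_const _).floor measurable_const
  set I : ℕ → ℤ → Set (Fin m → ℝ) := fun j k => toMeasurable volume (P '' (K ∩ S j k))
  set N : ℕ → (Fin m → ℝ) → ℝ≥0∞ := fun j w => ∑' k, (I j k).indicator 1 w with hN
  have hNm : ∀ j, Measurable (N j) := fun j =>
    Measurable.tsum fun k => measurable_one.indicator (measurableSet_toMeasurable _ _)
  have hNint : ∀ j, ∫⁻ w, N j w ≤ C * μ univ := by
    intro j
    rw [hN, lintegral_tsum fun k =>
      (measurable_one.indicator (measurableSet_toMeasurable _ _)).aemeasurable]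
    calc ∑' k, ∫⁻ w, (I j k).indicator 1 w = ∑' k, volume (P '' (K ∩ S j k)) := by
          congr 1 with k
          rw [lintegral_indicator_one (measurableSet_toMeasurable _ _), measure_toMeasurable]
      _ ≤ ∑' k, C * μ (S j k) := ENNReal.tsum_le_tsum fun k => hP _ (hSm j k)
      _ = C * μ (⋃ k, S j k) := by
          rw [ENNReal.tsum_mul_left, measure_iUnion _ (hSm j)]
          intro k l hkl
          refine disjoint_left.2 fun x hx hx' => hkl ?_
          exact hx.symm.trans hx'
      _ ≤ C * μ univ := by gcongr; exact subset_univ _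
  have hfat : ∫⁻ w, liminf (fun j => N j w) atTop ≠ ∞ := by
    refine ne_top_of_le_ne_top (b := C * μ univ) (by finiteness) ?_
    refine (lintegral_liminf_le hNm).trans ?_
    exact liminf_le_of_le (by isBoundedDefault) fun b hb => by
      obtain ⟨j, hj⟩ := hb.exists
      exact hj.trans (hNint j)
  have hae := ae_lt_top (Measurable.liminf hNm) hfat
  refine measure_mono_null (fun w hw => ?_) (ae_iff.1 hae)
  simp only [mem_ofPred_eq, not_lt, top_le_iff]
  refine ENNReal.eq_top_of_forall_nnreal_le fun r => ?_
  obtain ⟨n, hn⟩ := exists_nat_ge r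
  have hw : (t '' {x ∈ K | P x = w}).Infinite := hw
  obtain ⟨s, hs, hcard⟩ := hw.exists_subset_card_eq n
  have hinj : ∀ᶠ j in atTop, ∀ x ∈ s, ∀ y ∈ s, x ≠ y → 1 ≤ |x - y| * 2 ^ j := by
    rw [Filter.eventually_all_finset]
    intro x hx
    rw [Filter.eventually_all_finset]
    intro y hy
    by_cases hxy : x = y
    · simp [hxy]
    · have h1 : Tendsto (fun j : ℕ => |x - y| * (2 : ℝ) ^ j) atTop atTop :=
        (tendsto_pow_atTop_atTop_of_one_lt one_lt_two).const_mul_atTop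
          (abs_pos.2 (sub_ne_zero.2 hxy))
      filter_upwards [h1.eventually_ge_atTop 1] with j hj _ using hj
  refine le_liminf_of_le (by isBoundedDefault) ?_
  filter_upwards [hinj] with j hj
  have hInj : InjOn (fun x : ℝ => ⌊x * 2 ^ j⌋) s := by
    intro x hx y hy hxy
    by_contra hne
    have h1 := Int.abs_sub_lt_one_of_floor_eq_floor hxy
    rw [← sub_mul, abs_mul, abs_of_pos (show (0 : ℝ) < 2 ^ j by positivity)] at h1
    exact absurd (hj x hx y hy hne) (not_le.2 h1)
  calc (r : ℝ≥0∞) ≤ (n : ℝ≥0∞) := by exact_mod_cast hn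
    _ = ∑ k ∈ s.image (fun x : ℝ => ⌊x * 2 ^ j⌋), (1 : ℝ≥0∞) := by
        rw [Finset.sum_const, Finset.card_image_of_injOn hInj, hcard]; simp
    _ ≤ ∑ k ∈ s.image (fun x : ℝ => ⌊x * 2 ^ j⌋), (I j k).indicator 1 w := by
        refine Finset.sum_le_sum fun k hk => ?_
        obtain ⟨y, hy, rfl⟩ := Finset.mem_image.1 hk
        obtain ⟨x, hx, rfl⟩ := hs hy
        rw [indicator_of_mem]
        · rfl
        · exact subset_toMeasurable _ _ ⟨x, ⟨hx.1, rfl⟩, hx.2⟩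
    _ ≤ N j w := ENNReal.sum_le_tsum _

end Projections

section Slopes

variable {m : ℕ}

/-- The first coordinate on `ℝᵐ⁺¹`. -/
noncomputable def height (m : ℕ) : EuclideanSpace ℝ (Fin (m + 1)) →L[ℝ] ℝ :=
  EuclideanSpace.proj 0

/-- The last `m` coordinates on `ℝᵐ⁺¹`. -/
noncomputable def base (m : ℕ) : EuclideanSpace ℝ (Fin (m + 1)) →L[ℝ] (Fin m → ℝ) :=
  ContinuousLinearMap.pi fun i => EuclideanSpace.proj i.succ

/-- The linear projection of `ℝᵐ⁺¹` onto `ℝᵐ` along the direction `(1, v)`. -/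
noncomputable def slopeProj (v : Fin m → ℝ) : EuclideanSpace ℝ (Fin (m + 1)) →L[ℝ] (Fin m → ℝ) :=
  base m - (height m).smulRight v

/-- The points of `ℝᵐ⁺¹` with given first coordinate and last `m` coordinates. -/
noncomputable def liftPoint (m : ℕ) : (ℝ × (Fin m → ℝ)) →L[ℝ] EuclideanSpace ℝ (Fin (m + 1)) :=
  LinearMap.toContinuousLinearMap
    { toFun := fun p => WithLp.toLp 2 (Fin.cons p.1 p.2)
      map_add' := fun p q => by
        ext i
        refine Fin.cases ?_ (fun i => ?_) i <;> simp
      map_smul' := fun c p => by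
        ext i
        refine Fin.cases ?_ (fun i => ?_) i <;> simp }

@[simp] lemma height_liftPoint (p : ℝ × (Fin m → ℝ)) : height m (liftPoint m p) = p.1 := by
  simp [height, liftPoint]

@[simp] lemma base_liftPoint (p : ℝ × (Fin m → ℝ)) : base m (liftPoint m p) = p.2 := by
  ext i
  simp [base, liftPoint]

@[simp] lemma liftPoint_height_base (x : EuclideanSpace ℝ (Fin (m + 1))) :
    liftPoint m (height m x, base m x) = x := by
  ext i
  refine Fin.cases ?_ (fun i => ?_) i <;> simp [height, base, liftPoint]

lemma slopeProj_apply (v : Fin m → ℝ) (x : EuclideanSpace ℝ (Fin (m + 1))) :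
    slopeProj v x = base m x - height m x • v := by
  simp [slopeProj]

/-- The double cone with vertex `a`, axis `(1, v)`, aperture `s` and height `r`. -/
def doubleCone (v : Fin m → ℝ) (a : EuclideanSpace ℝ (Fin (m + 1))) (r s : ℝ) :
    Set (EuclideanSpace ℝ (Fin (m + 1))) :=
  {b | 0 < |height m b - height m a| ∧ |height m b - height m a| < r ∧
    dist (slopeProj v b) (slopeProj v a) ≤ s * |height m b - height m a|}

/-- The line through `a` with direction `(1, v)` meets `K \ {a}` within height `1 / (k + 1)`. -/
def LineHits (K : Set (EuclideanSpace ℝ (Fin (m + 1)))) (k : ℕ)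
    (a : EuclideanSpace ℝ (Fin (m + 1))) (v : Fin m → ℝ) : Prop :=
  ∃ b ∈ K, 0 < |height m b - height m a| ∧ |height m b - height m a| ≤ 1 / ((k : ℝ) + 1) ∧
    slopeProj v b = slopeProj v a

/-- The double cones at `a` with axis `(1, v)` and height less than `1 / (k + 1)` have uniformly
small density as the aperture tends to zero. -/
def ConeDensityZero (μ : Measure (EuclideanSpace ℝ (Fin (m + 1)))) (k : ℕ)
    (a : EuclideanSpace ℝ (Fin (m + 1))) (v : Fin m → ℝ) : Prop :=
  ∀ N : ℕ, ∃ j₀ : ℕ, ∀ j ≥ j₀, ∀ r : ℚ, 0 < (r : ℝ) → (r : ℝ) < 1 / ((k : ℝ) + 1) →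
    μ (doubleCone v a r (1 / ((j : ℝ) + 1))) ≤
      ((N : ℝ≥0∞) + 1)⁻¹ * ENNReal.ofReal ((r * (1 / ((j : ℝ) + 1))) ^ m)

/-- The double cones at `a` with axis `(1, v)`, height less than `1 / (k + 1)` and aperture less
than `1 / (i + 1)` have density at most `M`. -/
def ConeDensityLe (μ : Measure (EuclideanSpace ℝ (Fin (m + 1)))) (k M i : ℕ)
    (a : EuclideanSpace ℝ (Fin (m + 1))) (v : Fin m → ℝ) : Prop :=
  ∀ r s : ℚ, 0 < (r : ℝ) → (r : ℝ) < 1 / ((k : ℝ) + 1) → 0 < (s : ℝ) →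
    (s : ℝ) < 1 / ((i : ℝ) + 1) →
    μ (doubleCone v a r s) ≤ M * ENNReal.ofReal ((r * s : ℝ) ^ m)

lemma measurable_measure_doubleCone (μ : Measure (EuclideanSpace ℝ (Fin (m + 1)))) [SFinite μ]
    (r s : ℝ) :
    Measurable fun p : EuclideanSpace ℝ (Fin (m + 1)) × (Fin m → ℝ) =>
      μ (doubleCone p.2 p.1 r s) := by
  have hset : MeasurableSet {q : (EuclideanSpace ℝ (Fin (m + 1)) × (Fin m → ℝ)) ×
      EuclideanSpace ℝ (Fin (m + 1)) | q.2 ∈ doubleCone q.1.2 q.1.1 r s} := by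
    have h1 : Measurable fun q : (EuclideanSpace ℝ (Fin (m + 1)) × (Fin m → ℝ)) ×
        EuclideanSpace ℝ (Fin (m + 1)) => |height m q.2 - height m q.1.1| :=
      Continuous.measurable (by fun_prop)
    have h2 : Measurable fun q : (EuclideanSpace ℝ (Fin (m + 1)) × (Fin m → ℝ)) ×
        EuclideanSpace ℝ (Fin (m + 1)) => dist (slopeProj q.1.2 q.2) (slopeProj q.1.2 q.1.1) := by
      refine Continuous.measurable ?_
      simp only [slopeProj_apply]
      fun_prop
    exact (measurableSet_lt measurable_const h1).inter
      ((measurableSet_lt h1 measurable_const).inter (measurableSet_le h2 (h1.const_mul s)))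
  exact measurable_measure_prodMk_left hset

lemma measurableSet_lineHits {K : Set (EuclideanSpace ℝ (Fin (m + 1)))} (hK : IsCompact K)
    (k : ℕ) :
    MeasurableSet {p : EuclideanSpace ℝ (Fin (m + 1)) × (Fin m → ℝ) | LineHits K k p.1 p.2} := by
  have heq : {p : EuclideanSpace ℝ (Fin (m + 1)) × (Fin m → ℝ) | LineHits K k p.1 p.2} =
      ⋃ j : ℕ, Prod.fst '' {q : (EuclideanSpace ℝ (Fin (m + 1)) × (Fin m → ℝ)) × K |
        1 / ((j : ℝ) + 1) ≤ |height m q.2 - height m q.1.1| ∧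
        |height m q.2 - height m q.1.1| ≤ 1 / ((k : ℝ) + 1) ∧
        slopeProj q.1.2 q.2 = slopeProj q.1.2 q.1.1} := by
    ext p
    simp only [mem_ofPred_eq, mem_iUnion, mem_image]
    constructor
    · rintro ⟨b, hb, h0, h1, h2⟩
      obtain ⟨j, hj⟩ := exists_nat_one_div_lt h0
      exact ⟨j, (p, ⟨b, hb⟩), ⟨hj.le, h1, h2⟩, rfl⟩
    · rintro ⟨j, ⟨p, b⟩, ⟨h0, h1, h2⟩, rfl⟩
      exact ⟨b, b.2, lt_of_lt_of_le (by positivity) h0, h1, h2⟩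
  rw [heq]
  have : CompactSpace K := isCompact_iff_compactSpace.1 hK
  refine MeasurableSet.iUnion fun j => IsClosed.measurableSet ?_
  refine isClosedMap_fst_of_compactSpace _ ?_
  simp only [slopeProj_apply]
  refine IsClosed.and (isClosed_le (by fun_prop) (by fun_prop)) (IsClosed.and
    (isClosed_le (by fun_prop) (by fun_prop)) (isClosed_eq (by fun_prop) (by fun_prop)))

lemma measurableSet_coneDensityZero (μ : Measure (EuclideanSpace ℝ (Fin (m + 1)))) [SFinite μ]
    (k : ℕ) :
    MeasurableSet {p : EuclideanSpace ℝ (Fin (m + 1)) × (Fin m → ℝ) |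
      ConeDensityZero μ k p.1 p.2} := by
  refine measurableSet_setOfPred.2 (Measurable.forall fun N => Measurable.exists fun j₀ =>
    Measurable.forall fun j => Measurable.forall fun _ => Measurable.forall fun r =>
    Measurable.forall fun _ => Measurable.forall fun _ => ?_)
  exact measurableSet_setOfPred.1
    (measurableSet_le (measurable_measure_doubleCone μ _ _) measurable_const)

lemma measurableSet_coneDensityLe (μ : Measure (EuclideanSpace ℝ (Fin (m + 1)))) [SFinite μ]
    (k M i : ℕ) :
    MeasurableSet {p : EuclideanSpace ℝ (Fin (m + 1)) × (Fin m → ℝ) |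
      ConeDensityLe μ k M i p.1 p.2} := by
  refine measurableSet_setOfPred.2 (Measurable.forall fun r => Measurable.forall fun s =>
    Measurable.forall fun _ => Measurable.forall fun _ => Measurable.forall fun _ =>
    Measurable.forall fun _ => ?_)
  exact measurableSet_setOfPred.1
    (measurableSet_le (measurable_measure_doubleCone μ _ _) measurable_const)

/-- The slope of the line through `a` and `b`. -/
noncomputable def slopeFrom (a b : EuclideanSpace ℝ (Fin (m + 1))) : Fin m → ℝ :=
  (height m b - height m a)⁻¹ • (base m b - base m a)

lemma slopeProj_sub_slopeProj {a b : EuclideanSpace ℝ (Fin (m + 1))}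
    (h : height m b - height m a ≠ 0) (v : Fin m → ℝ) :
    slopeProj v b - slopeProj v a = (height m b - height m a) • (slopeFrom a b - v) := by
  rw [slopeFrom, smul_sub, smul_inv_smul₀ h, slopeProj_apply, slopeProj_apply, sub_smul]
  abel

lemma dist_slopeProj {a b : EuclideanSpace ℝ (Fin (m + 1))}
    (h : height m b - height m a ≠ 0) (v : Fin m → ℝ) :
    dist (slopeProj v b) (slopeProj v a) =
      dist (slopeFrom a b) v * |height m b - height m a| := by
  rw [dist_eq_norm, slopeProj_sub_slopeProj h, norm_smul, Real.norm_eq_abs, mul_comm,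
    dist_eq_norm]

/-- The normalized maximal distribution of slopes of the points of `μ` seen from `a`. -/
noncomputable def slopeMeasure (μ : Measure (EuclideanSpace ℝ (Fin (m + 1)))) (k : ℕ)
    (a : EuclideanSpace ℝ (Fin (m + 1))) : OuterMeasure (Fin m → ℝ) :=
  ⨆ r : {r : ℚ // 0 < (r : ℝ) ∧ (r : ℝ) < 1 / ((k : ℝ) + 1)},
    (ENNReal.ofReal ((r : ℝ) ^ m))⁻¹ • OuterMeasure.map (slopeFrom a) (OuterMeasure.restrict
      {b | 0 < |height m b - height m a| ∧ |height m b - height m a| < r} μ.toOuterMeasure)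

lemma slopeMeasure_apply (μ : Measure (EuclideanSpace ℝ (Fin (m + 1)))) (k : ℕ)
    (a : EuclideanSpace ℝ (Fin (m + 1))) (S : Set (Fin m → ℝ)) :
    slopeMeasure μ k a S = ⨆ r : {r : ℚ // 0 < (r : ℝ) ∧ (r : ℝ) < 1 / ((k : ℝ) + 1)},
      (ENNReal.ofReal ((r : ℝ) ^ m))⁻¹ * μ (slopeFrom a ⁻¹' S ∩
        {b | 0 < |height m b - height m a| ∧ |height m b - height m a| < r}) := by
  simp [slopeMeasure, OuterMeasure.iSup_apply]

lemma slopeMeasure_closedBall_le_iff (μ : Measure (EuclideanSpace ℝ (Fin (m + 1)))) (k : ℕ)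
    (a : EuclideanSpace ℝ (Fin (m + 1))) (v : Fin m → ℝ) (s : ℝ) (c : ℝ≥0∞) :
    slopeMeasure μ k a (closedBall v s) ≤ c * ENNReal.ofReal (s ^ m) ↔
      ∀ r : ℚ, 0 < (r : ℝ) → (r : ℝ) < 1 / ((k : ℝ) + 1) →
        μ (doubleCone v a r s) ≤ c * ENNReal.ofReal ((r * s) ^ m) := by
  rw [slopeMeasure_apply, iSup_le_iff, Subtype.forall]
  refine forall_congr' fun r => ?_
  refine Iff.trans ⟨fun h h0 h1 => h ⟨h0, h1⟩, fun h hr => h hr.1 hr.2⟩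
    (forall_congr' fun hr => forall_congr' fun _ => ?_)
  have hset : slopeFrom a ⁻¹' closedBall v s ∩
      {b | 0 < |height m b - height m a| ∧ |height m b - height m a| < r} = doubleCone v a r s := by
    ext b
    simp only [doubleCone, mem_inter_iff, mem_preimage, mem_closedBall, mem_ofPred_eq]
    constructor
    · rintro ⟨h, h0, hr⟩
      refine ⟨h0, hr, ?_⟩
      rw [dist_slopeProj (abs_pos.1 h0)]
      gcongr
    · rintro ⟨h0, hr, h⟩
      rw [dist_slopeProj (abs_pos.1 h0)] at h
      exact ⟨le_of_mul_le_mul_right h h0, h0, hr⟩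
  have h0 : ENNReal.ofReal ((r : ℝ) ^ m) ≠ 0 := (ENNReal.ofReal_pos.2 (by positivity)).ne'
  rw [hset, ENNReal.inv_mul_le_iff h0 ENNReal.ofReal_ne_top, ofReal_mul_pow hr.le, mul_left_comm]

/-- From a fixed point `a`, in almost every direction, either the line through `a` hits `K` close
to `a`, or the double cones have unbounded density, or they have zero density. -/
lemma volume_intermediate_density_eq_zero (μ : Measure (EuclideanSpace ℝ (Fin (m + 1))))
    [SFinite μ] {K : Set (EuclideanSpace ℝ (Fin (m + 1)))} (hK : IsCompact K) (hμK : μ Kᶜ = 0)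
    (k M i : ℕ) (a : EuclideanSpace ℝ (Fin (m + 1))) :
    volume {v : Fin m → ℝ | ¬ LineHits K k a v ∧ ConeDensityLe μ k M i a v ∧
      ¬ ConeDensityZero μ k a v} = 0 := by
  set G := {v : Fin m → ℝ | ¬ LineHits K k a v ∧ ConeDensityLe μ k M i a v ∧
      ¬ ConeDensityZero μ k a v}
  have hmeas : MeasurableSet G := by
    have hsec : Measurable fun v : Fin m → ℝ => (a, v) := by fun_prop
    exact (hsec (measurableSet_lineHits hK k)).compl.inter
      ((hsec (measurableSet_coneDensityLe μ k M i)).inter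
        (hsec (measurableSet_coneDensityZero μ k)).compl)
  by_contra hne
  obtain ⟨F, hFG, hFc, hF⟩ := hmeas.exists_lt_isCompact (pos_iff_ne_zero.2 hne)
  have hΦF : slopeMeasure μ k a F = 0 := by
    rw [slopeMeasure_apply, ENNReal.iSup_eq_zero]
    rintro ⟨r, hr0, hr1⟩
    refine mul_eq_zero_of_right _ (measure_mono_null ?_ hμK)
    rintro b ⟨hbF, hb0, hbr⟩ hbK
    refine (hFG hbF).1 ⟨b, hbK, hb0, hbr.le.trans hr1.le, ?_⟩
    rw [← sub_eq_zero, slopeProj_sub_slopeProj (abs_pos.1 hb0), sub_self, smul_zero]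
  have hae := ae_restrict_density_zero (slopeMeasure μ k a) hFc.isClosed hΦF
    (M := M) (by finiteness) (s₀ := 1 / ((i : ℝ) + 1)) (by positivity) fun v hv q hq0 hq1 =>
      (slopeMeasure_closedBall_le_iff μ k a v q M).2 fun r hr0 hr1 =>
        (hFG hv).2.1 r q hr0 hr1 hq0 hq1
  rw [ae_restrict_iff' hFc.measurableSet] at hae
  refine hF.ne' (measure_mono_null (fun v hv => ?_) (ae_iff.1 hae))
  intro h
  refine (hFG hv).2.2 fun N => ?_
  have hlim : Tendsto (fun j : ℕ => 1 / ((j : ℝ) + 1)) atTop (𝓝[>] 0) :=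
    tendsto_nhdsWithin_iff.2 ⟨tendsto_one_div_add_atTop_nhds_zero_nat,
      Eventually.of_forall fun j => by simp only [mem_Ioi]; positivity⟩
  obtain ⟨j₀, hj₀⟩ := eventually_atTop.1 (hlim.eventually (h hv ((N : ℝ≥0∞) + 1)⁻¹ (by simp)))
  exact ⟨j₀, fun j hj => (slopeMeasure_closedBall_le_iff μ k a v _ _).1 (hj₀ j hj)⟩

lemma ae_ae_not_intermediate_density (μ : Measure (EuclideanSpace ℝ (Fin (m + 1))))
    [SFinite μ] {K : Set (EuclideanSpace ℝ (Fin (m + 1)))} (hK : IsCompact K) (hμK : μ Kᶜ = 0) :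
    ∀ᵐ v : Fin m → ℝ, ∀ᵐ a ∂μ, ∀ k M i : ℕ, ¬ (¬ LineHits K k a v ∧ ConeDensityLe μ k M i a v ∧
      ¬ ConeDensityZero μ k a v) := by
  refine Measure.ae_ae_comm ?_ |>.1 ?_
  · exact measurableSet_setOfPred.2 (Measurable.forall fun k => Measurable.forall fun M =>
      Measurable.forall fun i => Measurable.not
        ((measurableSet_setOfPred.1 (measurableSet_lineHits hK k)).not.and
          ((measurableSet_setOfPred.1 (measurableSet_coneDensityLe μ k M i)).and
            (measurableSet_setOfPred.1 (measurableSet_coneDensityZero μ k)).not)))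
  · refine Eventually.of_forall fun a => ?_
    simp only [ae_all_iff]
    intro k M i
    refine ae_iff.2 ?_
    simpa only [not_not] using volume_intermediate_density_eq_zero μ hK hμK k M i a

end Slopes

section Unrectifiable

variable {m : ℕ} {K : Set (EuclideanSpace ℝ (Fin (m + 1)))}

lemma hausdorffMeasure_eq_volume_pi (m : ℕ) :
    (μH[(m : ℝ)] : Measure (Fin m → ℝ)) = volume := by
  simpa using hausdorffMeasure_pi_real (ι := Fin m)

lemma exists_volume_image_slopeProj_le (v : Fin m → ℝ) :
    ∃ C : ℝ≥0∞, C ≠ ∞ ∧ ∀ S : Set (EuclideanSpace ℝ (Fin (m + 1))),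
      volume (slopeProj v '' S) ≤ C * μH[(m : ℝ)] S := by
  refine ⟨(‖slopeProj v‖₊ : ℝ≥0∞) ^ (m : ℝ), by finiteness, fun S => ?_⟩
  rw [← hausdorffMeasure_eq_volume_pi]
  exact (slopeProj v).lipschitz.hausdorffMeasure_image_le (by positivity) S

/-- A subset of a purely unrectifiable set on which the height is a Lipschitz function of a linear
projection is null. -/
lemma hausdorffMeasure_graph_eq_zero
    (hunrect : ∀ f : EuclideanSpace ℝ (Fin m) → EuclideanSpace ℝ (Fin (m + 1)),
      (∃ L : ℝ≥0, LipschitzWith L f) → μH[(m : ℝ)] (K ∩ range f) = 0)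
    (v : Fin m → ℝ) {s : ℝ} (hs : 0 < s) {G : Set (EuclideanSpace ℝ (Fin (m + 1)))} (hGK : G ⊆ K)
    (hG : ∀ x ∈ G, ∀ y ∈ G, s * |height m y - height m x| ≤ dist (slopeProj v y) (slopeProj v x)) :
    μH[(m : ℝ)] G = 0 := by
  have hinj : InjOn (slopeProj v) G := by
    intro x hx y hy hxy
    have h1 := hG y hy x hx
    rw [hxy, dist_self] at h1
    have h2 : height m x = height m y := by
      have := nonpos_of_mul_nonpos_right h1 hs
      exact sub_eq_zero.1 (abs_nonpos_iff.1 this)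
    have h3 : base m x = base m y := by
      rw [slopeProj_apply, slopeProj_apply, h2] at hxy
      exact sub_left_injective hxy
    rw [← liftPoint_height_base x, h2, h3, liftPoint_height_base]
  have hlip : LipschitzOnWith (Real.toNNReal s⁻¹)
      (height m ∘ Function.invFunOn (slopeProj v) G) (slopeProj v '' G) := by
    refine LipschitzOnWith.of_dist_le_mul ?_
    rintro _ ⟨x, hx, rfl⟩ _ ⟨y, hy, rfl⟩
    simp only [Function.comp, hinj.leftInvOn_invFunOn hx, hinj.leftInvOn_invFunOn hy]
    rw [Real.coe_toNNReal _ (by positivity), Real.dist_eq, le_inv_mul_iff₀ hs]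
    exact hG y hy x hx
  obtain ⟨g, hg, hgeq⟩ := hlip.extend_real
  set f : EuclideanSpace ℝ (Fin m) → EuclideanSpace ℝ (Fin (m + 1)) :=
    fun q => liftPoint m (g (WithLp.ofLp q), WithLp.ofLp q + g (WithLp.ofLp q) • v) with hf
  have hg' : LipschitzWith _ fun q : Fin m → ℝ => (g q, q + g q • v) :=
    hg.prodMk (LipschitzWith.id.add
      ((ContinuousLinearMap.toSpanSingleton ℝ v).lipschitz.comp hg))
  have hflip : ∃ L : ℝ≥0, LipschitzWith L f :=
    ⟨_, (liftPoint m).lipschitz.comp (hg'.comp (PiLp.lipschitzWith_ofLp 2 fun _ : Fin m => ℝ))⟩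
  refine measure_mono_null ?_ (hunrect f hflip)
  intro x hx
  refine ⟨hGK hx, WithLp.toLp 2 (slopeProj v x), ?_⟩
  have hgx : g (slopeProj v x) = height m x := by
    rw [← hgeq (mem_image_of_mem _ hx), Function.comp, hinj.leftInvOn_invFunOn hx]
  simp only [hf, hgx]
  rw [slopeProj_apply, sub_add_cancel, liftPoint_height_base]

lemma measure_coneDensityZero_eq_zero (hK : IsCompact K)
    (hunrect : ∀ f : EuclideanSpace ℝ (Fin m) → EuclideanSpace ℝ (Fin (m + 1)),
      (∃ L : ℝ≥0, LipschitzWith L f) → μH[(m : ℝ)] (K ∩ range f) = 0)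
    (v : Fin m → ℝ) (k : ℕ) :
    μH[(m : ℝ)] {a ∈ K | ConeDensityZero (μH[(m : ℝ)].restrict K) k a v} = 0 := by
  set μ : Measure (EuclideanSpace ℝ (Fin (m + 1))) := μH[(m : ℝ)].restrict K with hμ
  set δ : ℝ := 1 / ((k : ℝ) + 1)
  have hδ0 : 0 < δ := by positivity
  obtain ⟨R, hR⟩ := (hK.image (slopeProj v).continuous).isBounded.subset_closedBall 0
  set A : ℕ → ℕ → ℤ → Set (EuclideanSpace ℝ (Fin (m + 1))) := fun N j₀ z =>
    {a ∈ K | (∀ j ≥ j₀, ∀ r : ℚ, 0 < (r : ℝ) → (r : ℝ) < δ →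
      μ (doubleCone v a r (1 / ((j : ℝ) + 1))) ≤
        ((N : ℝ≥0∞) + 1)⁻¹ * ENNReal.ofReal ((r * (1 / ((j : ℝ) + 1))) ^ m)) ∧
      ⌊height m a * (8 / δ)⌋ = z}
  set C : ℝ≥0∞ := 2 * ENNReal.ofReal (40 ^ m) * volume (closedBall (0 : Fin m → ℝ) (R + δ)) with hC
  have hCtop : C ≠ ∞ := by
    have := (measure_closedBall_lt_top (μ := volume) (x := (0 : Fin m → ℝ)) (r := R + δ)).ne
    finiteness
  have hAle : ∀ N j₀ z, μ (A N j₀ z) ≤ C * ((N : ℝ≥0∞) + 1)⁻¹ := by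
    intro N j₀ z
    refine (measure_le_of_cone_measure_le μ (slopeProj v) (height m) (A := A N j₀ z)
      (s := 1 / ((j₀ : ℝ) + 1)) (δ := δ) (R := R) 0 ((N : ℝ≥0∞) + 1)⁻¹ (by positivity) ?_ hδ0
      (fun x hx r hr0 hr1 => hx.2.1 j₀ le_rfl r hr0 hr1) (fun x hx y hy => ?_)
      (fun x hx => hR (mem_image_of_mem _ hx.1)) fun G hGA hG => ?_).trans_eq ?_
    · rw [div_le_one (by positivity)]
      linarith [(Nat.cast_nonneg j₀ : (0 : ℝ) ≤ j₀)]
    · have h1 := Int.abs_sub_lt_one_of_floor_eq_floor (hy.2.2.trans hx.2.2.symm)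
      rw [← sub_mul, abs_mul, abs_of_pos (show 0 < 8 / δ by positivity), ← lt_div_iff₀
        (by positivity), one_div_div] at h1
      exact h1.le
    · exact Measure.absolutelyContinuous_of_le Measure.restrict_le_self
        (hausdorffMeasure_graph_eq_zero hunrect v (by positivity) (fun x hx => (hGA hx).1) hG)
    · rw [hC]; ring
  have hz : ∀ z : ℤ, μ {a ∈ K | ConeDensityZero μ k a v ∧ ⌊height m a * (8 / δ)⌋ = z} = 0 := by
    intro z
    have hle : ∀ N : ℕ, μ {a ∈ K | ConeDensityZero μ k a v ∧ ⌊height m a * (8 / δ)⌋ = z} ≤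
        C * ((N : ℝ≥0∞) + 1)⁻¹ := by
      intro N
      have hmono : Monotone fun j₀ => A N j₀ z := fun i j hij a ha =>
        ⟨ha.1, fun l hl => ha.2.1 l (hij.trans hl), ha.2.2⟩
      calc μ {a ∈ K | ConeDensityZero μ k a v ∧ ⌊height m a * (8 / δ)⌋ = z}
          ≤ μ (⋃ j₀, A N j₀ z) := by
            refine measure_mono fun a ha => ?_
            obtain ⟨j₀, hj₀⟩ := ha.2.1 N
            exact mem_iUnion.2 ⟨j₀, ha.1, hj₀, ha.2.2⟩
        _ = ⨆ j₀, μ (A N j₀ z) := hmono.measure_iUnion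
        _ ≤ _ := iSup_le fun j₀ => hAle N j₀ z
    refine le_antisymm (ge_of_tendsto' (x := atTop) ?_ hle) zero_le
    have h1 : Tendsto (fun N : ℕ => ((N : ℝ≥0∞) + 1)⁻¹) atTop (𝓝 0) := by
      have := (tendsto_add_atTop_iff_nat 1).2 ENNReal.tendsto_inv_nat_nhds_zero
      simpa using this
    simpa using ENNReal.Tendsto.const_mul h1 (Or.inr hCtop)
  have hall : μ {a ∈ K | ConeDensityZero μ k a v} = 0 := by
    refine measure_mono_null (fun a ha => ?_) (measure_iUnion_null hz)
    exact mem_iUnion.2 ⟨_, ha.1, ha.2, rfl⟩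
  rwa [hμ, Measure.restrict_eq_self _ fun a ha => ha.1] at hall

lemma infinite_height_fibre {v : Fin m → ℝ} {a : EuclideanSpace ℝ (Fin (m + 1))}
    (h : ∀ k, LineHits K k a v) :
    (height m '' {x ∈ K | slopeProj v x = slopeProj v a}).Infinite := by
  intro hfin
  set D := height m '' {x ∈ K | slopeProj v x = slopeProj v a}
  have hcl : (D \ {height m a})ᶜ ∈ 𝓝 (height m a) :=
    (hfin.subset sdiff_subset).isClosed.isOpen_compl.mem_nhds (by simp)
  obtain ⟨ε, hε, hball⟩ := Metric.mem_nhds_iff.1 hcl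
  obtain ⟨k, hk⟩ := exists_nat_one_div_lt hε
  obtain ⟨b, hbK, hb0, hbk, hb⟩ := h k
  refine hball (a := height m b) ?_ ⟨⟨b, ⟨hbK, hb⟩, rfl⟩, ?_⟩
  · rw [mem_ball, Real.dist_eq]
    exact hbk.trans_lt hk
  · exact fun h0 => abs_pos.1 hb0 (sub_eq_zero.2 h0)

/-- The Besicovitch–Federer projection theorem in codimension one: a purely unrectifiable compact
set of finite measure has null projection along almost every direction. -/
lemma ae_volume_slopeProj_image_eq_zero (hK : IsCompact K) (hKfin : μH[(m : ℝ)] K < ∞)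
    (hunrect : ∀ f : EuclideanSpace ℝ (Fin m) → EuclideanSpace ℝ (Fin (m + 1)),
      (∃ L : ℝ≥0, LipschitzWith L f) → μH[(m : ℝ)] (K ∩ range f) = 0) :
    ∀ᵐ v : Fin m → ℝ, volume (slopeProj v '' K) = 0 := by
  set μ : Measure (EuclideanSpace ℝ (Fin (m + 1))) := μH[(m : ℝ)].restrict K with hμ
  have : IsFiniteMeasure μ := ⟨by rwa [hμ, Measure.restrict_apply_univ]⟩
  have hμK : μ Kᶜ = 0 := by
    rw [hμ, Measure.restrict_apply hK.measurableSet.compl, compl_inter_self, measure_empty]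
  filter_upwards [ae_ae_not_intermediate_density μ hK hμK] with v hv
  obtain ⟨C, hC, hCle⟩ := exists_volume_image_slopeProj_le v
  have himage : ∀ S, μH[(m : ℝ)] S = 0 → volume (slopeProj v '' S) = 0 := fun S hS =>
    le_antisymm ((hCle S).trans (by rw [hS, mul_zero])) zero_le
  rw [hμ, ae_restrict_iff' hK.measurableSet] at hv
  set ν := μ.map (slopeProj v) with hν
  have hfib := volume_infinite_fibre_eq_zero μ (slopeProj v) (height m).continuous.measurable K hC
    fun S hS => (hCle _).trans_eq (by rw [hμ, Measure.restrict_apply hS, inter_comm])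
  have hzero : volume (⋃ k, slopeProj v '' {a ∈ K | ConeDensityZero μ k a v}) = 0 :=
    measure_iUnion_null fun k => himage _ (measure_coneDensityZero_eq_zero hK hunrect v k)
  refine measure_mono_null ?_ (measure_union_null (measure_union_null (himage _ (ae_iff.1 hv)) hzero)
    (measure_union_null hfib (volume_infinite_density_eq_zero ν)))
  rintro _ ⟨a, haK, rfl⟩
  by_cases hbad : a ∈ K → ∀ k M i : ℕ, ¬ (¬ LineHits K k a v ∧ ConeDensityLe μ k M i a v ∧
      ¬ ConeDensityZero μ k a v)
  swap
  · exact Or.inl (Or.inl (mem_image_of_mem _ hbad))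
  by_cases hz : ∃ k, ConeDensityZero μ k a v
  · obtain ⟨k, hk⟩ := hz
    exact Or.inl (Or.inr (mem_iUnion.2 ⟨k, a, ⟨haK, hk⟩, rfl⟩))
  by_cases hhit : ∀ k, LineHits K k a v
  · exact Or.inr (Or.inl (infinite_height_fibre hhit))
  refine Or.inr (Or.inr fun M η hη => ?_)
  push Not at hz hhit
  obtain ⟨k, hk⟩ := hhit
  obtain ⟨i, hi⟩ := exists_nat_one_div_lt hη
  have hM : ¬ ConeDensityLe μ k M i a v := fun h => hbad haK k M i ⟨hk, h, hz k⟩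
  unfold ConeDensityLe at hM
  push Not at hM
  obtain ⟨r, s, hr0, hr1, hs0, hs1, hlt⟩ := hM
  have hr1 : (r : ℝ) < 1 := hr1.trans_le (by
    rw [div_le_one (by positivity)]
    linarith [(Nat.cast_nonneg k : (0 : ℝ) ≤ k)])
  refine ⟨r * s, by positivity, by nlinarith, hlt.trans_le ?_⟩
  rw [hν, Measure.map_apply (slopeProj v).continuous.measurable isClosed_closedBall.measurableSet]
  refine measure_mono fun b hb => ?_
  rw [mem_preimage, mem_closedBall, mul_comm]
  exact hb.2.2.trans (by gcongr; exact hb.2.1.le)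

end Unrectifiable

section Radial

lemma norm_inv_smul_sub_le {V : Type*} [NormedAddCommGroup V] [NormedSpace ℝ V] {x y : V}
    (hx : x ≠ 0) (hy : y ≠ 0) :
    ‖‖x‖⁻¹ • x - ‖y‖⁻¹ • y‖ ≤ 2 * ‖x‖⁻¹ * ‖x - y‖ := by
  have hx' : 0 < ‖x‖ := norm_pos_iff.2 hx
  have hy' : 0 < ‖y‖ := norm_pos_iff.2 hy
  have heq : ‖x‖⁻¹ • x - ‖y‖⁻¹ • y = ‖x‖⁻¹ • (x - y) + (‖x‖⁻¹ - ‖y‖⁻¹) • y := by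
    rw [smul_sub, sub_smul]; abel
  have hinv : ‖x‖⁻¹ - ‖y‖⁻¹ = ‖x‖⁻¹ * (‖y‖ - ‖x‖) * ‖y‖⁻¹ := by
    field_simp
  calc ‖‖x‖⁻¹ • x - ‖y‖⁻¹ • y‖ ≤ ‖x‖⁻¹ * ‖x - y‖ + ‖x‖⁻¹ * |‖y‖ - ‖x‖| * ‖y‖⁻¹ * ‖y‖ := by
        rw [heq]
        refine (norm_add_le _ _).trans_eq ?_
        rw [norm_smul, norm_smul, hinv, norm_mul, norm_mul, norm_inv, norm_inv, norm_norm,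
          norm_norm, Real.norm_eq_abs]
    _ = ‖x‖⁻¹ * ‖x - y‖ + ‖x‖⁻¹ * |‖x‖ - ‖y‖| := by
        rw [mul_assoc _ ‖y‖⁻¹, inv_mul_cancel₀ hy'.ne', mul_one, abs_sub_comm]
    _ ≤ ‖x‖⁻¹ * ‖x - y‖ + ‖x‖⁻¹ * ‖x - y‖ := by
        gcongr
        exact abs_norm_sub_norm_le x y
    _ = _ := by ring

lemma lipschitzOnWith_norm_inv_smul {V : Type*} [NormedAddCommGroup V] [NormedSpace ℝ V] {c : ℝ}
    (hc : 0 < c) :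
    LipschitzOnWith (Real.toNNReal (2 * c⁻¹)) (fun x : V => ‖x‖⁻¹ • x) {x | c ≤ ‖x‖} := by
  refine LipschitzOnWith.of_dist_le_mul fun x hx y hy => ?_
  rw [Real.coe_toNNReal _ (by positivity), dist_eq_norm, dist_eq_norm]
  have hx : c ≤ ‖x‖ := hx
  have hy : c ≤ ‖y‖ := hy
  refine (norm_inv_smul_sub_le (norm_pos_iff.1 (hc.trans_le hx))
    (norm_pos_iff.1 (hc.trans_le hy))).trans ?_
  gcongr

lemma hausdorffMeasure_norm_inv_smul_image_eq_zero {V : Type*} [NormedAddCommGroup V]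
    [NormedSpace ℝ V] [MeasurableSpace V] [BorelSpace V] {d : ℝ} (hd : 0 ≤ d) {S : Set V}
    (hS : μH[d] S = 0) : μH[d] ((fun x : V => ‖x‖⁻¹ • x) '' (S \ {0})) = 0 := by
  have hk : ∀ k : ℕ, μH[d] ((fun x : V => ‖x‖⁻¹ • x) '' (S ∩ {x | 1 / ((k : ℝ) + 1) ≤ ‖x‖})) = 0 := by
    intro k
    refine le_antisymm (((lipschitzOnWith_norm_inv_smul (show 0 < 1 / ((k : ℝ) + 1) by
      positivity)).mono inter_subset_right).hausdorffMeasure_image_le hd |>.trans ?_) zero_le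
    rw [measure_mono_null inter_subset_left hS, mul_zero]
  refine measure_mono_null ?_ (measure_iUnion_null hk)
  rintro _ ⟨x, ⟨hx, hx0⟩, rfl⟩
  obtain ⟨k, hk⟩ := exists_nat_one_div_lt (norm_pos_iff.2 hx0)
  exact mem_iUnion.2 ⟨k, x, ⟨hx, hk.le⟩, rfl⟩

lemma radialProj_union {n : ℕ} (x : EuclideanSpace ℝ (Fin n))
    (A B : Set (EuclideanSpace ℝ (Fin n))) :
    radialProj x (A ∪ B) = radialProj x A ∪ radialProj x B := by
  rw [radialProj, union_sdiff_distrib, image_union]; rfl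

lemma radialProj_iUnion {n : ℕ} {ι : Sort*} (x : EuclideanSpace ℝ (Fin n))
    (A : ι → Set (EuclideanSpace ℝ (Fin n))) :
    radialProj x (⋃ i, A i) = ⋃ i, radialProj x (A i) := by
  rw [radialProj, iUnion_sdiff, image_iUnion]; rfl

lemma radialProj_eq_image {n : ℕ} (x : EuclideanSpace ℝ (Fin n))
    (A : Set (EuclideanSpace ℝ (Fin n))) :
    radialProj x A = (fun z => ‖z‖⁻¹ • z) '' (((fun y => y - x) '' A) \ {0}) := by
  ext z
  constructor
  · rintro ⟨y, ⟨hy, hyx⟩, rfl⟩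
    exact ⟨y - x, ⟨⟨y, hy, rfl⟩, fun h => hyx (sub_eq_zero.1 h)⟩, rfl⟩
  · rintro ⟨_, ⟨⟨y, hy, rfl⟩, hyx⟩, rfl⟩
    exact ⟨y, ⟨hy, fun h => hyx (sub_eq_zero.2 h)⟩, rfl⟩

lemma hausdorffMeasure_radialProj_eq_zero {n : ℕ} {d : ℝ} (hd : 0 ≤ d)
    (x : EuclideanSpace ℝ (Fin n)) {A : Set (EuclideanSpace ℝ (Fin n))} (hA : μH[d] A = 0) :
    μH[d] (radialProj x A) = 0 := by
  rw [radialProj_eq_image]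
  refine hausdorffMeasure_norm_inv_smul_image_eq_zero hd ?_
  have h := (LipschitzWith.id.sub (LipschitzWith.const x)).hausdorffMeasure_image_le hd A
  rw [hA, mul_zero] at h
  exact le_antisymm h zero_le

variable {m : ℕ} {K : Set (EuclideanSpace ℝ (Fin (m + 1)))}

lemma slopeProj_surjective (v : Fin m → ℝ) : Function.Surjective (slopeProj v) := fun w =>
  ⟨liftPoint m (0, w), by simp [slopeProj_apply]⟩

lemma height_surjective : Function.Surjective (height m) := fun t =>
  ⟨liftPoint m (t, 0), by simp⟩

/-- From almost every point, almost every line misses a compact set with null projections. -/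
lemma ae_ae_slopeProj_notMem (hK : IsCompact K)
    (hproj : ∀ᵐ v : Fin m → ℝ, volume (slopeProj v '' K) = 0) :
    ∀ᵐ x : EuclideanSpace ℝ (Fin (m + 1)), ∀ᵐ v : Fin m → ℝ, slopeProj v x ∉ slopeProj v '' K := by
  refine (Measure.ae_ae_comm ?_).1 ?_
  · refine (IsClosed.measurableSet ?_).compl
    have : CompactSpace K := isCompact_iff_compactSpace.1 hK
    have heq : {p : (Fin m → ℝ) × EuclideanSpace ℝ (Fin (m + 1)) |
        slopeProj p.1 p.2 ∈ slopeProj p.1 '' K} = Prod.fst ''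
        {q : ((Fin m → ℝ) × EuclideanSpace ℝ (Fin (m + 1))) × K |
          slopeProj q.1.1 q.2 = slopeProj q.1.1 q.1.2} := by
      ext p
      constructor
      · rintro ⟨b, hb, hbp⟩
        exact ⟨(p, ⟨b, hb⟩), hbp, rfl⟩
      · rintro ⟨⟨p, b⟩, hbp, rfl⟩
        exact ⟨b, b.2, hbp⟩
    change IsClosed {p : (Fin m → ℝ) × EuclideanSpace ℝ (Fin (m + 1)) |
        slopeProj p.1 p.2 ∈ slopeProj p.1 '' K}
    rw [heq]
    refine isClosedMap_fst_of_compactSpace _ ?_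
    simp only [slopeProj_apply]
    exact isClosed_eq (by fun_prop) (by fun_prop)
  · filter_upwards [hproj] with v hv
    have hm : MeasurableSet (slopeProj v '' K)ᶜ :=
      (hK.image (slopeProj v).continuous).measurableSet.compl
    refine (ae_comp_linearMap_mem_iff (slopeProj v).toLinearMap volume volume
      (slopeProj_surjective v) hm).2 ?_
    exact measure_eq_zero_iff_ae_notMem.1 hv

lemma ae_hausdorffMeasure_inter_height_eq_zero (hK : MeasurableSet K)
    (hKfin : μH[(m : ℝ)] K < ∞) :
    ∀ᵐ x : EuclideanSpace ℝ (Fin (m + 1)),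
      μH[(m : ℝ)] {y ∈ K | height m y = height m x} = 0 := by
  set μ : Measure (EuclideanSpace ℝ (Fin (m + 1))) := μH[(m : ℝ)].restrict K with hμ
  have : IsFiniteMeasure μ := ⟨by rwa [hμ, Measure.restrict_apply_univ]⟩
  have hcount := Measure.countable_meas_level_set_pos (μ := μ) (height m).continuous.measurable
  have h := (ae_comp_linearMap_mem_iff (height m).toLinearMap
    (volume : Measure (EuclideanSpace ℝ (Fin (m + 1)))) volume height_surjective
    hcount.measurableSet.compl).2 (measure_eq_zero_iff_ae_notMem.1 (hcount.measure_zero volume))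
  filter_upwards [h] with x hx
  have hx0 : μ {y | height m y = height m x} = 0 := by
    by_contra hne
    exact hx (pos_iff_ne_zero.2 hne)
  rwa [hμ, Measure.restrict_apply' hK, inter_comm] at hx0

lemma hausdorffMeasure_radialProj_eq_zero_of_slopes {x : EuclideanSpace ℝ (Fin (m + 1))}
    (hlevel : μH[(m : ℝ)] {y ∈ K | height m y = height m x} = 0)
    (hslopes : ∀ᵐ v : Fin m → ℝ, slopeProj v x ∉ slopeProj v '' K) :
    μH[(m : ℝ)] (radialProj x K) = 0 := by
  have hd : (0 : ℝ) ≤ m := by positivity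
  set V : Set (Fin m → ℝ) := {v | slopeProj v x ∈ slopeProj v '' K}
  have hV0 : μH[(m : ℝ)] V = 0 := by
    rw [hausdorffMeasure_eq_volume_pi]
    exact measure_eq_zero_iff_ae_notMem.2 hslopes
  have hlift : ∀ c : ℝ, μH[(m : ℝ)] ((fun v => c • liftPoint m (1, v)) '' V) = 0 := by
    intro c
    have hl : LipschitzWith _ fun v : Fin m → ℝ => c • liftPoint m (1, v) :=
      (lipschitzWith_smul c).comp
        ((liftPoint m).lipschitz.comp ((LipschitzWith.const (1 : ℝ)).prodMk LipschitzWith.id))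
    have h := hl.hausdorffMeasure_image_le hd V
    rw [hV0, mul_zero] at h
    exact le_antisymm h zero_le
  refine measure_mono_null ?_ (measure_union_null
    (hausdorffMeasure_radialProj_eq_zero hd x hlevel) (measure_union_null
      (hausdorffMeasure_norm_inv_smul_image_eq_zero hd (hlift 1))
      (hausdorffMeasure_norm_inv_smul_image_eq_zero hd (hlift (-1)))))
  rintro _ ⟨y, ⟨hyK, hyx⟩, rfl⟩
  by_cases hyh : height m y = height m x
  · exact Or.inl ⟨y, ⟨⟨hyK, hyh⟩, hyx⟩, rfl⟩
  right
  have hne : height m y - height m x ≠ 0 := sub_ne_zero.2 hyh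
  set v := slopeFrom x y with hv
  have hvV : v ∈ V := ⟨y, hyK, by
    rw [← sub_eq_zero, slopeProj_sub_slopeProj hne, sub_self, smul_zero]⟩
  have hsub : y - x = (height m y - height m x) • liftPoint m (1, v) := by
    rw [← liftPoint_height_base (y - x), ← map_smul, map_sub, map_sub]
    congr 1
    ext i
    · simp
    · simp [hv, slopeFrom, hne]
  have hl0 : liftPoint m (1, v) ≠ 0 := by
    intro h0
    have := height_liftPoint ((1, v) : ℝ × (Fin m → ℝ))
    rw [h0, map_zero] at this
    exact zero_ne_one this
  have hscale : ∀ c : ℝ, 0 < c → ∀ z : EuclideanSpace ℝ (Fin (m + 1)),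
      ‖c • z‖⁻¹ • c • z = ‖z‖⁻¹ • z := by
    intro c hc z
    rw [norm_smul, Real.norm_of_nonneg hc.le, smul_smul, mul_inv, mul_right_comm,
      inv_mul_cancel₀ hc.ne', one_mul]
  rcases hne.lt_or_gt with hneg | hpos
  · right
    refine ⟨(-1 : ℝ) • liftPoint m (1, v), ⟨⟨v, hvV, rfl⟩, by simpa using hl0⟩, ?_⟩
    simp only
    have hsub' : y - x =
        (-(height m y - height m x)) • ((-1 : ℝ) • liftPoint m (1, v)) := by
      rw [hsub, smul_smul]
      congr 1
      ring
    rw [hsub', hscale (-(height m y - height m x)) (by linarith)]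
  · left
    refine ⟨(1 : ℝ) • liftPoint m (1, v), ⟨⟨v, hvV, rfl⟩, by simpa using hl0⟩, ?_⟩
    simp only
    rw [hsub, hscale _ hpos, one_smul]

lemma exists_isCompact_seq_ae_cover {X : Type*} [TopologicalSpace X] [MeasurableSpace X]
    [OpensMeasurableSpace X] [T2Space X] (μ : Measure X) [μ.InnerRegularCompactLTTop]
    {B : Set X} (hB : MeasurableSet B)
    (hfin : μ B ≠ ∞) :
    ∃ K : ℕ → Set X, (∀ k, IsCompact (K k)) ∧ (∀ k, K k ⊆ B) ∧ μ (B \ ⋃ k, K k) = 0 := by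
  have h : ∀ k : ℕ, ∃ K ⊆ B, IsCompact K ∧ μ (B \ K) < ((k : ℝ≥0∞) + 1)⁻¹ := fun k =>
    hB.exists_isCompact_sdiff_lt hfin (by simp)
  choose K hKB hK hlt using h
  refine ⟨K, hK, hKB, le_antisymm ?_ zero_le⟩
  have hlim : Tendsto (fun N : ℕ => ((N : ℝ≥0∞) + 1)⁻¹) atTop (𝓝 0) := by
    have := (tendsto_add_atTop_iff_nat 1).2 ENNReal.tendsto_inv_nat_nhds_zero
    simpa using this
  refine ge_of_tendsto' hlim fun k => ?_
  exact (measure_mono (sdiff_subset_sdiff_right (subset_iUnion K k))).trans (hlt k).le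

end Radial

/-- A purely `(n-1)`-unrectifiable Borel set `B ⊆ ℝⁿ` with `0 < H^{n-1}(B) < ∞` is invisible
from Lebesgue-almost every point of `ℝⁿ` (a consequence of the Besicovitch–Federer projection
theorem). -/
theorem unrectifiable_invisible_ae (n : ℕ) (hn : 2 ≤ n)
    (B : Set (EuclideanSpace ℝ (Fin n))) (hB : MeasurableSet B)
    (hB0 : 0 < μH[(n : ℝ) - 1] B) (hBfin : μH[(n : ℝ) - 1] B < ∞)
    (hunrect : ∀ f : EuclideanSpace ℝ (Fin (n - 1)) → EuclideanSpace ℝ (Fin n),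
      (∃ L : ℝ≥0, LipschitzWith L f) → μH[(n : ℝ) - 1] (B ∩ Set.range f) = 0) :
    ∀ᵐ x ∂(volume : Measure (EuclideanSpace ℝ (Fin n))),
      μH[(n : ℝ) - 1] (radialProj x B) = 0 := by
  obtain ⟨m, rfl⟩ : ∃ m, n = m + 1 := ⟨n - 1, by omega⟩
  have hd : ((m + 1 : ℕ) : ℝ) - 1 = m := by push_cast; ring
  rw [hd] at hBfin hunrect ⊢
  set μ : Measure (EuclideanSpace ℝ (Fin (m + 1))) := μH[(m : ℝ)].restrict B with hμ
  have : IsFiniteMeasure μ := ⟨by rwa [hμ, Measure.restrict_apply_univ]⟩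
  obtain ⟨K, hK, hKB, hcover⟩ := exists_isCompact_seq_ae_cover μ hB (measure_ne_top μ B)
  rw [hμ, Measure.restrict_eq_self _ sdiff_subset] at hcover
  have hKfin : ∀ k, μH[(m : ℝ)] (K k) < ∞ := fun k => (measure_mono (hKB k)).trans_lt hBfin
  have hall : ∀ᵐ x : EuclideanSpace ℝ (Fin (m + 1)), ∀ k, μH[(m : ℝ)] (radialProj x (K k)) = 0 := by
    refine ae_all_iff.2 fun k => ?_
    have hproj := ae_volume_slopeProj_image_eq_zero (hK k) (hKfin k) fun f hf =>
      measure_mono_null (inter_subset_inter_left _ (hKB k)) (hunrect f hf)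
    filter_upwards [ae_ae_slopeProj_notMem (hK k) hproj,
      ae_hausdorffMeasure_inter_height_eq_zero (hK k).measurableSet (hKfin k)] with x h1 h2
    exact hausdorffMeasure_radialProj_eq_zero_of_slopes h2 h1
  filter_upwards [hall] with x hx
  rw [← union_sdiff_cancel (iUnion_subset hKB), radialProj_union, radialProj_iUnion]
  exact measure_union_null (measure_iUnion_null hx)
    (hausdorffMeasure_radialProj_eq_zero (by positivity) x hcover)
end
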